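/- arXiv:2509.00898 — 2 statements merged into one kernel-verified Lean document; each statement's English description precedes it below -/
import Mathlib

section
/- For every bounded continuous function f : 𝕋² × (Γ\G) → ℝ one has lim_{T→∞} ∫_{[0,1]²} f((x₁,x₂), Γ·n(x₁,x₂)·a(−T)) dx₁dx₂ = ∫_{[0,1]²} ∫_{Γ\G} f(x, g) dμ(g) dx; that is, the expanding translates of the closed horosphere Γ·N under a(−T) equidistribute in Γ\G with respect to Haar measure. -/
open Matrix MeasureTheory Filter Topology

noncomputable section

/-- `G = SL(3, ℝ)`. -/
abbrev SL3R := Matrix.SpecialLinearGroup (Fin 3) ℝ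

instance : TopologicalSpace SL3R :=
  show TopologicalSpace {A : Matrix (Fin 3) (Fin 3) ℝ // A.det = 1} from inferInstance

/-- `Γ = SL(3, ℤ)`, viewed as a subgroup of `SL(3, ℝ)`. -/
def Gamma3 : Subgroup SL3R :=
  (Matrix.SpecialLinearGroup.map (n := Fin 3) (Int.castRingHom ℝ)).range

/-- The homogeneous space `Γ \ G`, i.e. the set of right cosets `Γ g`. -/
def X3 := Quotient (QuotientGroup.rightRel Gamma3)

instance : TopologicalSpace X3 := instTopologicalSpaceQuotient

instance : MeasurableSpace X3 := borel X3

/-- The projection `G → Γ \ G`, `g ↦ Γ g`. -/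
def proj3 : SL3R → X3 := Quotient.mk''

/-- The right action of `G` on `Γ \ G`: `Γ x ↦ Γ x g`. -/
def rmul3 (g : SL3R) : X3 → X3 :=
  Quotient.map' (· * g) (fun a b h => by
    rw [QuotientGroup.rightRel_apply] at h ⊢
    simpa [_root_.mul_inv_rev, ← mul_assoc] using h)

/-- The unipotent matrices `n(x₁, x₂)` with rows `(1,0,0), (x₁,1,0), (x₂,0,1)`. -/
def nmat (x₁ x₂ : ℝ) : SL3R :=
  ⟨!![(1:ℝ), 0, 0; x₁, 1, 0; x₂, 0, 1], by
    simp [Matrix.det_fin_three]⟩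

/-- The diagonal matrices `a(t) = diag(e^{-2t}, e^t, e^t)`. -/
def amat (t : ℝ) : SL3R :=
  ⟨Matrix.diagonal ![Real.exp (-2 * t), Real.exp t, Real.exp t], by
    rw [Matrix.det_diagonal, Fin.prod_univ_three]
    simp only [Matrix.cons_val_zero, Matrix.cons_val_one, Matrix.head_cons,
      Matrix.cons_val_two, Matrix.tail_cons, ← Real.exp_add]
    norm_num
    ring⟩


/-! ### Topological and measurable structure of `G` and `Γ \ G` -/

theorem sl3_isEmbedding : IsEmbedding (Subtype.val : SL3R → Matrix (Fin 3) (Fin 3) ℝ) :=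
  IsEmbedding.subtypeVal

theorem sl3_isClosedEmbedding :
    IsClosedEmbedding (Subtype.val : SL3R → Matrix (Fin 3) (Fin 3) ℝ) := by
  apply IsClosed.isClosedEmbedding_subtypeVal
  exact isClosed_eq (Continuous.matrix_det continuous_id) continuous_const

instance : IsTopologicalGroup SL3R :=
  show @IsTopologicalGroup SL3R Matrix.SpecialLinearGroup.instTopologicalSpace _ from inferInstance

instance : T2Space SL3R := sl3_isEmbedding.t2Space

instance : SecondCountableTopology SL3R :=
  haveI : SecondCountableTopology (Matrix (Fin 3) (Fin 3) ℝ) :=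
    inferInstanceAs (SecondCountableTopology (Fin 3 → Fin 3 → ℝ))
  sl3_isEmbedding.secondCountableTopology

instance : LocallyCompactSpace SL3R :=
  haveI : LocallyCompactSpace (Matrix (Fin 3) (Fin 3) ℝ) :=
    inferInstanceAs (LocallyCompactSpace (Fin 3 → Fin 3 → ℝ))
  sl3_isClosedEmbedding.locallyCompactSpace

instance : MeasurableSpace SL3R := borel SL3R

instance : BorelSpace SL3R := ⟨rfl⟩

instance : BorelSpace X3 := ⟨rfl⟩

theorem continuous_sl3_apply (i j : Fin 3) : Continuous fun g : SL3R => g i j :=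
  (sl3_isEmbedding.continuous).matrix_elem i j

theorem proj3_surjective : Function.Surjective proj3 := Quotient.mk''_surjective

theorem proj3_continuous : Continuous proj3 := continuous_quotient_mk'

theorem proj3_eq_iff (g h : SL3R) : proj3 g = proj3 h ↔ h * g⁻¹ ∈ Gamma3 := by
  refine Iff.trans (Quotient.eq'' (s₁ := QuotientGroup.rightRel Gamma3)) ?_
  rw [QuotientGroup.rightRel_apply]

theorem rmul3_proj3 (g h : SL3R) : rmul3 g (proj3 h) = proj3 (h * g) := rfl

theorem rmul3_mul (g h : SL3R) (y : X3) : rmul3 (g * h) y = rmul3 h (rmul3 g y) := by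
  obtain ⟨k, rfl⟩ := proj3_surjective y
  simp [rmul3_proj3, mul_assoc]

theorem rmul3_one (y : X3) : rmul3 1 y = y := by
  obtain ⟨k, rfl⟩ := proj3_surjective y
  simp [rmul3_proj3]

theorem proj3_isOpenMap : IsOpenMap proj3 := by
  intro U hU
  have : IsOpen (proj3 ⁻¹' (proj3 '' U)) := by
    have h2 : proj3 ⁻¹' (proj3 '' U) = ⋃ γ ∈ Gamma3, (fun g => γ * g) ⁻¹' U := by
      ext g
      simp only [Set.mem_preimage, Set.mem_image, Set.mem_iUnion, exists_prop]
      constructor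
      · rintro ⟨h, hU, hh⟩
        rw [proj3_eq_iff] at hh
        refine ⟨h * g⁻¹, ?_, by simpa using hU⟩
        simpa using Gamma3.inv_mem hh
      · rintro ⟨γ, hγ, hU⟩
        refine ⟨γ * g, hU, ?_⟩
        rw [proj3_eq_iff]
        simpa using Gamma3.inv_mem hγ
    rw [h2]
    exact isOpen_biUnion fun γ _ => hU.preimage (continuous_const_mul γ)
  exact this

theorem proj3_isOpenQuotientMap : IsOpenQuotientMap proj3 :=
  ⟨proj3_surjective, proj3_continuous, proj3_isOpenMap⟩

instance : SecondCountableTopology X3 :=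
  proj3_isOpenQuotientMap.isQuotientMap.secondCountableTopology proj3_isOpenMap

theorem continuous_rmul3 : Continuous fun p : X3 × SL3R => rmul3 p.2 p.1 := by
  have h := proj3_isOpenQuotientMap.prodMap (IsOpenQuotientMap.id (X := SL3R))
  rw [← h.continuous_comp_iff]
  have : (fun p : X3 × SL3R => rmul3 p.2 p.1) ∘ Prod.map proj3 id
      = fun p : SL3R × SL3R => proj3 (p.1 * p.2) := by
    ext p
    rfl
  rw [this]
  exact proj3_continuous.comp continuous_mul

theorem continuous_rmul3_left (g : SL3R) : Continuous (rmul3 g) :=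
  continuous_rmul3.comp (Continuous.prodMk_left g)

theorem continuous_rmul3_right (y : X3) : Continuous fun g => rmul3 g y :=
  continuous_rmul3.comp (Continuous.prodMk_right y)

theorem measurable_rmul3 : Measurable fun p : X3 × SL3R => rmul3 p.2 p.1 :=
  continuous_rmul3.measurable

theorem mp_rmul3 {μ : Measure X3} (hμinv : ∀ g : SL3R, Measure.map (rmul3 g) μ = μ) (g : SL3R) :
    MeasurePreserving (rmul3 g) μ μ :=
  ⟨(continuous_rmul3_left g).measurable, hμinv g⟩

/-- Haar measure on `G`. -/
def mG : Measure SL3R := Measure.haar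

instance : Measure.IsHaarMeasure mG := by unfold mG; infer_instance

/-- Null sets of `μ` are exactly those whose lift is Haar-null. -/
theorem null_iff {μ : Measure X3} [IsProbabilityMeasure μ]
    (hμinv : ∀ g : SL3R, Measure.map (rmul3 g) μ = μ) {A : Set X3} (hA : MeasurableSet A) :
    μ A = 0 ↔ mG (proj3 ⁻¹' A) = 0 := by
  have hS : MeasurableSet ((fun p : X3 × SL3R => rmul3 p.2 p.1) ⁻¹' A) := measurable_rmul3 hA
  have h1 := Measure.prod_apply (μ := μ) (ν := mG) hS
  have h2 := Measure.prod_apply_symm (μ := μ) (ν := mG) hS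
  have e1 : ∀ y : X3, mG (Prod.mk y ⁻¹' ((fun p : X3 × SL3R => rmul3 p.2 p.1) ⁻¹' A))
      = mG (proj3 ⁻¹' A) := by
    intro y
    obtain ⟨k, rfl⟩ := proj3_surjective y
    exact measure_preimage_mul mG k (proj3 ⁻¹' A)
  have e2 : ∀ g : SL3R, μ ((fun y => (y, g)) ⁻¹' ((fun p : X3 × SL3R => rmul3 p.2 p.1) ⁻¹' A))
      = μ A := by
    intro g
    exact (mp_rmul3 hμinv g).measure_preimage hA.nullMeasurableSet
  simp_rw [e1] at h1
  simp_rw [e2] at h2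
  rw [h1] at h2
  simp only [lintegral_const, measure_univ, mul_one] at h2
  rw [h2]
  have : mG Set.univ ≠ 0 := by
    simp [NeZero.ne]
  simp [this]


/-! ### The Mautner phenomenon -/

section Mautner

variable {H : Type*} [NormedAddCommGroup H] [InnerProductSpace ℝ H]

theorem li_mul_apply (A B : H →ₗᵢ[ℝ] H) (v : H) : (A * B) v = A (B v) := rfl

theorem li_one_apply (v : H) : (1 : H →ₗᵢ[ℝ] H) v = v := rfl

theorem fixed_of_inner_eq (A : H →ₗᵢ[ℝ] H) (v : H) (h : inner ℝ (A v) v = inner ℝ v v) :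
    A v = v := by
  have h1 : ‖A v - v‖ ^ 2 = 0 := by
    rw [@norm_sub_sq_real, h, A.norm_map, real_inner_self_eq_norm_sq]
    ring
  rw [← sub_eq_zero, ← norm_eq_zero]
  exact pow_eq_zero_iff (two_ne_zero) |>.1 h1

theorem mautner (π : SL3R →* (H →ₗᵢ[ℝ] H)) (hπ : ∀ v, Continuous fun g => π g v)
    (U L D : ℝ → SL3R) (hL : Continuous L) (hL0 : L 0 = 1)
    (hrel : ∀ a ε : ℝ, a ≠ 0 → ε ≠ 0 →
      U ((a - 1) / ε) * L ε * U ((a⁻¹ - 1) / ε) = D a * L (a * ε))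
    (v : H) (hv : ∀ b, π (U b) v = v) :
    (∀ c, π (L c) v = v) ∧ (∀ a, a ≠ 0 → π (D a) v = v) := by
  have hU : ∀ b w, inner ℝ (π (U b) w) v = inner ℝ w v := by
    intro b w
    conv_lhs => rw [← hv b]
    exact (π (U b)).inner_map_map w v
  have key : ∀ a ε : ℝ, a ≠ 0 → ε ≠ 0 →
      inner ℝ (π (L ε) v) v = inner ℝ (π (D a) (π (L (a * ε)) v)) v := by
    intro a ε ha hε
    have h1 : π (D a) (π (L (a * ε)) v) = π (U ((a - 1) / ε)) (π (L ε) v) := by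
      have := congrArg (fun g => π g v) (hrel a ε ha hε)
      simp only [map_mul, li_mul_apply] at this
      rw [← this, hv]
    rw [h1, hU]
  have hLv : Continuous fun c => π (L c) v := (hπ v).comp hL
  have hL0v : π (L 0) v = v := by rw [hL0]; simp
  have lim1 : Tendsto (fun ε : ℝ => inner ℝ (π (L ε) v) v) (𝓝[≠] 0) (𝓝 (inner ℝ v v)) := by
    have : Continuous fun ε : ℝ => inner ℝ (π (L ε) v) v := hLv.inner continuous_const
    have h2 := this.tendsto 0
    simp only [hL0v] at h2
    exact h2.mono_left nhdsWithin_le_nhds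
  have hD : ∀ a, a ≠ 0 → π (D a) v = v := by
    intro a ha
    apply fixed_of_inner_eq
    have lim2 : Tendsto (fun ε : ℝ => inner ℝ (π (D a) (π (L (a * ε)) v)) v) (𝓝[≠] 0)
        (𝓝 (inner ℝ (π (D a) v) v)) := by
      have : Continuous fun ε : ℝ => inner ℝ (π (D a) (π (L (a * ε)) v)) v :=
        ((π (D a)).continuous.comp (hLv.comp (continuous_const_mul a))).inner continuous_const
      have h2 := this.tendsto 0
      simp only [mul_zero, hL0v] at h2
      exact h2.mono_left nhdsWithin_le_nhds
    refine tendsto_nhds_unique lim2 (lim1.congr' ?_)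
    filter_upwards [self_mem_nhdsWithin] with ε hε
    exact key a ε ha hε
  refine ⟨fun c => ?_, hD⟩
  by_cases hc : c = 0
  · rw [hc, hL0v]
  apply fixed_of_inner_eq
  have hconst : ∀ a, a ≠ 0 → inner ℝ (π (L c) v) v = inner ℝ (π (L (a * c)) v) v := by
    intro a ha
    rw [key a c ha hc]
    conv_lhs => rw [← hD a ha]
    rw [hD a ha]
    conv_lhs =>
      arg 3
      rw [← hD a ha]
    exact (π (D a)).inner_map_map _ v
  have lim3 : Tendsto (fun a : ℝ => inner ℝ (π (L (a * c)) v) v) (𝓝[≠] 0)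
      (𝓝 (inner ℝ v v)) := by
    have : Continuous fun a : ℝ => inner ℝ (π (L (a * c)) v) v :=
      (hLv.comp (continuous_mul_const c)).inner continuous_const
    have h2 := this.tendsto 0
    simp only [zero_mul, hL0v] at h2
    exact h2.mono_left nhdsWithin_le_nhds
  refine tendsto_nhds_unique (tendsto_const_nhds.congr' ?_) lim3
  filter_upwards [self_mem_nhdsWithin] with a ha
  exact hconst a ha

/-- Elementary matrices in `SL(3,ℝ)`. -/
def tv (i j : Fin 3) (h : i ≠ j) (c : ℝ) : SL3R :=
  ⟨Matrix.transvection i j c, Matrix.det_transvection_of_ne i j h c⟩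

theorem tv_coe (i j : Fin 3) (h : i ≠ j) (c : ℝ) :
    (tv i j h c : Matrix (Fin 3) (Fin 3) ℝ) = Matrix.transvection i j c := rfl

theorem continuous_sl3 {α : Type*} [TopologicalSpace α] {f : α → SL3R}
    (h : ∀ i j, Continuous fun x => f x i j) : Continuous f :=
  sl3_isEmbedding.continuous_iff.2 (continuous_matrix h)

theorem continuous_tv (i j : Fin 3) (h : i ≠ j) : Continuous (tv i j h) := by
  refine continuous_sl3 fun k l => ?_
  simp only [tv_coe, Matrix.transvection, Matrix.add_apply, Matrix.single_apply]
  split_ifs <;> fun_prop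

theorem tv_zero (i j : Fin 3) (h : i ≠ j) : tv i j h 0 = 1 := by
  ext k l
  simp [tv_coe]

/-- Diagonal matrices in `SL(3,ℝ)`. -/
def dg (d : Fin 3 → ℝ) (h : d 0 * d 1 * d 2 = 1) : SL3R :=
  ⟨Matrix.diagonal d, by rw [Matrix.det_diagonal, Fin.prod_univ_three, h]⟩

def d1 (a : ℝ) : SL3R := if h : a = 0 then 1 else dg ![a, a⁻¹, 1] (by simp [h])

def d2 (a : ℝ) : SL3R := if h : a = 0 then 1 else dg ![a, 1, a⁻¹] (by simp [h])

theorem d1_coe (a : ℝ) (ha : a ≠ 0) :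
    (d1 a : Matrix (Fin 3) (Fin 3) ℝ) = Matrix.diagonal ![a, a⁻¹, 1] := by
  simp only [d1, ha, dite_false]
  rfl

theorem rel1 (a ε : ℝ) (ha : a ≠ 0) (hε : ε ≠ 0) :
    tv 0 1 (by decide) ((a - 1) / ε) * tv 1 0 (by decide) ε * tv 0 1 (by decide) ((a⁻¹ - 1) / ε)
      = d1 a * tv 1 0 (by decide) (a * ε) := by
  ext i j
  simp only [Matrix.SpecialLinearGroup.coe_mul, tv_coe, d1_coe a ha]
  fin_cases i <;> fin_cases j <;>
    simp [Matrix.mul_apply, Fin.sum_univ_three, Matrix.transvection, Matrix.single_apply,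
      Matrix.one_apply, Matrix.diagonal_apply] <;> field_simp <;> ring

theorem d2_coe (a : ℝ) (ha : a ≠ 0) :
    (d2 a : Matrix (Fin 3) (Fin 3) ℝ) = Matrix.diagonal ![a, 1, a⁻¹] := by
  simp only [d2, ha, dite_false]
  rfl

theorem rel2 (a ε : ℝ) (ha : a ≠ 0) (hε : ε ≠ 0) :
    tv 0 2 (by decide) ((a - 1) / ε) * tv 2 0 (by decide) ε * tv 0 2 (by decide) ((a⁻¹ - 1) / ε)
      = d2 a * tv 2 0 (by decide) (a * ε) := by
  ext i j
  simp only [Matrix.SpecialLinearGroup.coe_mul, tv_coe, d2_coe a ha]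
  fin_cases i <;> fin_cases j <;>
    simp [Matrix.mul_apply, Fin.sum_univ_three, Matrix.transvection, Matrix.single_apply,
      Matrix.one_apply, Matrix.diagonal_apply] <;> field_simp <;> ring

theorem tv12_eq (c : ℝ) : tv 1 2 (by decide) c =
    tv 1 0 (by decide) c * tv 0 2 (by decide) 1 * tv 1 0 (by decide) (-c)
      * tv 0 2 (by decide) (-1) := by
  ext i j
  simp only [Matrix.SpecialLinearGroup.coe_mul, tv_coe]
  fin_cases i <;> fin_cases j <;>
    simp [Matrix.mul_apply, Fin.sum_univ_three, Matrix.transvection, Matrix.single_apply,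
      Matrix.one_apply]

theorem tv21_eq (c : ℝ) : tv 2 1 (by decide) c =
    tv 2 0 (by decide) c * tv 0 1 (by decide) 1 * tv 2 0 (by decide) (-c)
      * tv 0 1 (by decide) (-1) := by
  ext i j
  simp only [Matrix.SpecialLinearGroup.coe_mul, tv_coe]
  fin_cases i <;> fin_cases j <;>
    simp [Matrix.mul_apply, Fin.sum_univ_three, Matrix.transvection, Matrix.single_apply,
      Matrix.one_apply]

theorem dg_eq (d : Fin 3 → ℝ) (h : d 0 * d 1 * d 2 = 1) :
    dg d h = d1 (d 1)⁻¹ * d2 (d 2)⁻¹ := by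
  have h1 : d 1 ≠ 0 := by rintro h'; simp [h'] at h
  have h2 : d 2 ≠ 0 := by rintro h'; simp [h'] at h
  ext i j
  rw [Matrix.SpecialLinearGroup.coe_mul, d1_coe _ (inv_ne_zero h1), d2_coe _ (inv_ne_zero h2)]
  change Matrix.diagonal d i j = _
  rw [Matrix.diagonal_mul_diagonal]
  simp only [Matrix.diagonal_apply]
  split_ifs with hij
  · fin_cases i <;> simp
    field_simp
    linarith
  · rfl

/-- A vector fixed by the contracted horospherical subgroup is fixed by all of `G`. -/
theorem fixed_all (π : SL3R →* (H →ₗᵢ[ℝ] H)) (hπ : ∀ v, Continuous fun g => π g v)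
    (v : H) (hv1 : ∀ b, π (tv 0 1 (by decide) b) v = v)
    (hv2 : ∀ b, π (tv 0 2 (by decide) b) v = v) (g : SL3R) : π g v = v := by
  obtain ⟨h10, hd1⟩ := mautner π hπ _ _ _ (continuous_tv 1 0 (by decide)) (tv_zero _ _ _) rel1 v hv1
  obtain ⟨h20, hd2⟩ := mautner π hπ _ _ _ (continuous_tv 2 0 (by decide)) (tv_zero _ _ _) rel2 v hv2
  have h12 : ∀ c, π (tv 1 2 (by decide) c) v = v := by
    intro c
    rw [tv12_eq]
    simp only [map_mul, li_mul_apply, hv2, h10]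
  have h21 : ∀ c, π (tv 2 1 (by decide) c) v = v := by
    intro c
    rw [tv21_eq]
    simp only [map_mul, li_mul_apply, hv1, h20]
  have htv : ∀ i j h c, π (tv i j h c) v = v := by
    intro i j h c
    fin_cases i <;> fin_cases j
    · exact absurd rfl h
    · exact hv1 c
    · exact hv2 c
    · exact h10 c
    · exact absurd rfl h
    · exact h12 c
    · exact h20 c
    · exact h21 c
    · exact absurd rfl h
  have hdiag : ∀ d h, π (dg d h) v = v := by
    intro d h
    have e1 : d 1 ≠ 0 := by rintro h'; simp [h'] at h
    have e2 : d 2 ≠ 0 := by rintro h'; simp [h'] at h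
    rw [dg_eq]
    simp only [map_mul, li_mul_apply]
    rw [hd2 _ (inv_ne_zero e2), hd1 _ (inv_ne_zero e1)]
  have main : ∃ h : (g : Matrix (Fin 3) (Fin 3) ℝ).det = 1, π ⟨g, h⟩ v = v := by
    refine Matrix.diagonal_transvection_induction
      (fun M => ∃ h : M.det = 1, π ⟨M, h⟩ v = v) (g : Matrix (Fin 3) (Fin 3) ℝ) ?_ ?_ ?_
    · intro D hD
      rw [g.2] at hD
      refine ⟨hD, ?_⟩
      rw [Matrix.det_diagonal, Fin.prod_univ_three] at hD
      exact hdiag D hD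
    · intro t
      exact ⟨t.det, htv t.i t.j t.hij t.c⟩
    · rintro A B ⟨hA, hA'⟩ ⟨hB, hB'⟩
      refine ⟨by rw [Matrix.det_mul, hA, hB, one_mul], ?_⟩
      let A' : SL3R := ⟨A, hA⟩
      let B' : SL3R := ⟨B, hB⟩
      change π (A' * B') v = v
      rw [map_mul, li_mul_apply]
      rw [show π B' v = v from hB', show π A' v = v from hA']
  obtain ⟨_, h⟩ := main
  exact h

theorem amat_coe (t : ℝ) : (amat t : Matrix (Fin 3) (Fin 3) ℝ) =
    Matrix.diagonal ![Real.exp (-2 * t), Real.exp t, Real.exp t] := rfl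

theorem amat_inv (T : ℝ) : (amat T)⁻¹ = amat (-T) := by
  rw [inv_eq_iff_mul_eq_one]
  ext i j
  simp only [Matrix.SpecialLinearGroup.coe_mul, amat_coe, Matrix.diagonal_mul_diagonal,
    Matrix.SpecialLinearGroup.coe_one, Matrix.diagonal_apply, Matrix.one_apply]
  split_ifs with h
  · fin_cases i <;> simp [← Real.exp_add]
  · rfl

theorem amat_conj_apply (T : ℝ) (g : SL3R) (i j : Fin 3) :
    (amat T * g * amat (-T)) i j =
      (![Real.exp (-2 * T), Real.exp T, Real.exp T] i) * g i j *
        (![Real.exp (2 * T), Real.exp (-T), Real.exp (-T)] j) := by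
  simp only [Matrix.SpecialLinearGroup.coe_mul, amat_coe, Matrix.mul_diagonal, Matrix.diagonal_mul]
  simp

theorem amat_conj_tv (T c : ℝ) (j : Fin 3) (h : 0 ≠ j) :
    amat T * tv 0 j h c * amat (-T) = tv 0 j h (Real.exp (-3 * T) * c) := by
  have e : Real.exp (-3 * T) = Real.exp (-2 * T) * Real.exp (-T) := by
    rw [← Real.exp_add]; congr 1; ring
  have e1 : Real.exp (-2 * T) * Real.exp (2 * T) = 1 := by
    rw [← Real.exp_add]; simp
  have e2 : Real.exp T * Real.exp (-T) = 1 := by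
    rw [← Real.exp_add]; simp
  ext k l
  rw [amat_conj_apply, e]
  simp only [tv_coe, Matrix.transvection, Matrix.add_apply, Matrix.single_apply, Matrix.one_apply]
  fin_cases j <;> fin_cases k <;> fin_cases l <;> simp at h e1 ⊢ <;> linarith

/-- Weak limits along `a(-T)` are fixed vectors. -/
theorem weak_limit [CompleteSpace H] (π : SL3R →* (H →ₗᵢ[ℝ] H))
    (hπ : ∀ v, Continuous fun g => π g v) (v : H) (F : Ultrafilter ℝ) (hF : (F : Filter ℝ) ≤ atTop) :
    ∃ v₀ : H, (∀ g, π g v₀ = v₀) ∧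
      ∀ w, Tendsto (fun T => inner ℝ (π (amat (-T)) v) w) F (𝓝 (inner ℝ v₀ w)) := by
  obtain ⟨v₀, hv₀⟩ : ∃ v₀ : H,
      ∀ w, Tendsto (fun T => inner ℝ (π (amat (-T)) v) w) F (𝓝 (inner ℝ v₀ w)) := by
    let Φ : ℝ → WeakDual ℝ H := fun T =>
      StrongDual.toWeakDual (InnerProductSpace.toDual ℝ H (π (amat (-T)) v))
    have hc := WeakDual.isCompact_closedBall (𝕜 := ℝ) (E := H) 0 ‖v‖
    have hmem : ∀ T, Φ T ∈ (WeakDual.toStrongDual ⁻¹' Metric.closedBall 0 ‖v‖ :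
        Set (WeakDual ℝ H)) := by
      intro T
      simp only [Set.mem_preimage, mem_closedBall_zero_iff]
      change ‖InnerProductSpace.toDual ℝ H (π (amat (-T)) v)‖ ≤ ‖v‖
      simp
    obtain ⟨ℓ, -, hℓ⟩ := hc.ultrafilter_le_nhds (F.map Φ) (by
      rw [le_principal_iff]
      exact Ultrafilter.mem_map.2 (Filter.univ_mem' hmem))
    refine ⟨(InnerProductSpace.toDual ℝ H).symm (WeakDual.toStrongDual ℓ), fun w => ?_⟩
    rw [InnerProductSpace.toDual_symm_apply]
    exact ((WeakDual.eval_continuous w).tendsto ℓ).comp hℓ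
  refine ⟨v₀, ?_, hv₀⟩
  have hfix : ∀ (j : Fin 3) (h : 0 ≠ j) b, π (tv 0 j h b) v₀ = v₀ := by
    intro j h b
    refine ext_inner_right ℝ fun w => ?_
    have e1 : inner ℝ (π (tv 0 j h b) v₀) w = inner ℝ v₀ (π (tv 0 j h b)⁻¹ w) := by
      rw [← (π (tv 0 j h b)).inner_map_map v₀, ← li_mul_apply, ← map_mul]
      simp
    have t1 := hv₀ (π (tv 0 j h b)⁻¹ w)
    rw [← e1] at t1
    have e2 : ∀ T, inner ℝ (π (amat (-T)) v) (π (tv 0 j h b)⁻¹ w) =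
        inner ℝ (π (amat (-T)) v) w +
        inner ℝ (π (amat (-T)) (π (tv 0 j h (Real.exp (-3 * T) * b)) v - v)) w := by
      intro T
      have e3 : inner ℝ (π (amat (-T)) v) (π (tv 0 j h b)⁻¹ w) =
          inner ℝ (π (tv 0 j h b) (π (amat (-T)) v)) w := by
        rw [← (π (tv 0 j h b)).inner_map_map (π (amat (-T)) v), ← li_mul_apply
          (π (tv 0 j h b)) (π (tv 0 j h b)⁻¹), ← map_mul]
        simp
      rw [e3, ← inner_add_left, ← map_add, add_sub_cancel, ← li_mul_apply,
        ← li_mul_apply, ← map_mul, ← map_mul, ← amat_conj_tv, ← amat_inv T]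
      congr 3
      group
    simp_rw [e2] at t1
    have t2 : Tendsto (fun T =>
        inner ℝ (π (amat (-T)) (π (tv 0 j h (Real.exp (-3 * T) * b)) v - v)) w) F (𝓝 0) := by
      have t3 : Tendsto (fun T => ‖π (tv 0 j h (Real.exp (-3 * T) * b)) v - v‖ * ‖w‖) F (𝓝 0) := by
        have c1 : Continuous fun s : ℝ => ‖π (tv 0 j h (s * b)) v - v‖ * ‖w‖ := by
          have := (hπ v).comp ((continuous_tv 0 j h).comp (continuous_mul_const b))
          exact ((this.sub continuous_const).norm).mul continuous_const
        have c2 := c1.tendsto 0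
        simp only [zero_mul, tv_zero, map_one, li_one_apply, sub_self, norm_zero] at c2
        refine c2.comp (Tendsto.mono_left ?_ hF)
        refine Real.tendsto_exp_atBot.comp ?_
        exact tendsto_id.const_mul_atTop_of_neg (by norm_num)
      refine squeeze_zero_norm (fun T => ?_) t3
      refine (norm_inner_le_norm _ _).trans ?_
      rw [LinearIsometry.norm_map]
    have t4 := (hv₀ w).add t2
    rw [add_zero] at t4
    exact tendsto_nhds_unique t1 t4
  exact fixed_all π hπ v₀ (hfix 1 (by decide)) (hfix 2 (by decide))

end Mautner


/-! ### The regular representation on `L²(Γ \ G)` and mixing -/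

section Regular

open scoped symmDiff

variable {μ : Measure X3} [IsProbabilityMeasure μ]

/-- The right regular representation. -/
def rho (hμinv : ∀ g : SL3R, Measure.map (rmul3 g) μ = μ) :
    SL3R →* (Lp ℝ 2 μ →ₗᵢ[ℝ] Lp ℝ 2 μ) where
  toFun g := Lp.compMeasurePreservingₗᵢ ℝ (rmul3 g) (mp_rmul3 hμinv g)
  map_one' := by
    ext1 v
    have h : rmul3 1 = id := funext rmul3_one
    change Lp.compMeasurePreserving (rmul3 1) (mp_rmul3 hμinv 1) v = v
    have := Lp.compMeasurePreserving_id_apply v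
    convert this
  map_mul' g h := by
    ext1 v
    have e : rmul3 (g * h) = rmul3 h ∘ rmul3 g := funext (rmul3_mul g h)
    change Lp.compMeasurePreserving (rmul3 (g * h)) (mp_rmul3 hμinv (g * h)) v =
      Lp.compMeasurePreserving (rmul3 g) (mp_rmul3 hμinv g)
        (Lp.compMeasurePreserving (rmul3 h) (mp_rmul3 hμinv h) v)
    rw [← Lp.compMeasurePreserving_comp_apply]
    congr

theorem rho_coeFn (hμinv : ∀ g : SL3R, Measure.map (rmul3 g) μ = μ) (g : SL3R) (v : Lp ℝ 2 μ) :
    rho hμinv g v =ᵐ[μ] v ∘ rmul3 g :=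
  Lp.coeFn_compMeasurePreserving v (mp_rmul3 hμinv g)

theorem symmDiff_tendsto_open (hμinv : ∀ g : SL3R, Measure.map (rmul3 g) μ = μ)
    {O : Set X3} (hO : IsOpen O) :
    Tendsto (fun g => μ.real ((rmul3 g ⁻¹' O) ∆ O)) (𝓝 1) (𝓝 0) := by
  have hm : ∀ g, MeasurableSet (rmul3 g ⁻¹' O) := fun g =>
    (hO.preimage (continuous_rmul3_left g)).measurableSet
  have h1 : Tendsto (fun g => μ (O \ (rmul3 g ⁻¹' O))) (𝓝 1) (𝓝 (μ ∅)) := by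
    refine tendsto_measure_of_ae_tendsto_indicator_of_isFiniteMeasure _ MeasurableSet.empty
      (fun g => hO.measurableSet.diff (hm g)) (ae_of_all _ fun y => ?_)
    by_cases hy : y ∈ O
    · have h2 : ∀ᶠ g in 𝓝 (1 : SL3R), rmul3 g y ∈ O := by
        apply (continuous_rmul3_right y).continuousAt.eventually_mem
        rw [rmul3_one]
        exact hO.mem_nhds hy
      filter_upwards [h2] with g hg
      simp [hg]
    · simp [hy]
  have h3 : ∀ g, μ.real ((rmul3 g ⁻¹' O) ∆ O) = 2 * μ.real (O \ (rmul3 g ⁻¹' O)) := by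
    intro g
    rw [measureReal_symmDiff_eq (hm g) hO.measurableSet]
    have e1 := measureReal_sdiff_add_inter (μ := μ) (s := O) (hm g)
    have e2 := measureReal_sdiff_add_inter (μ := μ) (s := rmul3 g ⁻¹' O) hO.measurableSet
    have e3 : μ.real (rmul3 g ⁻¹' O) = μ.real O :=
      (mp_rmul3 hμinv g).measureReal_preimage hO.measurableSet.nullMeasurableSet
    rw [Set.inter_comm] at e2
    linarith
  simp_rw [h3]
  have h4 := (ENNReal.tendsto_toReal (measure_ne_top μ ∅)).comp h1
  simp only [measure_empty, ENNReal.toReal_zero] at h4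
  have h5 := h4.const_mul 2
  rw [mul_zero] at h5
  exact h5

theorem symmDiff_tendsto (hμinv : ∀ g : SL3R, Measure.map (rmul3 g) μ = μ)
    {A : Set X3} (hA : MeasurableSet A) :
    Tendsto (fun g => μ.real ((rmul3 g ⁻¹' A) ∆ A)) (𝓝 1) (𝓝 0) := by
  refine MeasurableSpace.induction_on_inter
    (C := fun A _ => Tendsto (fun g => μ.real ((rmul3 g ⁻¹' A) ∆ A)) (𝓝 1) (𝓝 0))
    (s := {s : Set X3 | IsOpen s}) (BorelSpace.measurable_eq (α := X3)) isPiSystem_isOpen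
    ?_ ?_ ?_ ?_ A hA
  · simp
  · intro t ht
    exact symmDiff_tendsto_open hμinv ht
  · intro t _ h
    simpa only [Set.preimage_compl, compl_symmDiff_compl] using h
  · intro f hd hf h
    have hsum : Summable fun i => 2 * μ.real (f i) := (summable_measure_toReal hf hd).mul_left 2
    have hmp : ∀ g i, μ.real (rmul3 g ⁻¹' (f i)) = μ.real (f i) := fun g i =>
      (mp_rmul3 hμinv g).measureReal_preimage (hf i).nullMeasurableSet
    have hle : ∀ g i, μ.real ((rmul3 g ⁻¹' (f i)) ∆ (f i)) ≤ 2 * μ.real (f i) := by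
      intro g i
      have : (rmul3 g ⁻¹' (f i)) ∆ (f i) ⊆ (rmul3 g ⁻¹' (f i)) ∪ f i := symmDiff_le_sup
      refine (measureReal_mono this).trans ((measureReal_union_le _ _).trans ?_)
      rw [hmp]
      linarith
    have h1 := tendsto_tsum_of_dominated_convergence (𝓕 := 𝓝 (1 : SL3R))
      (f := fun g i => μ.real ((rmul3 g ⁻¹' (f i)) ∆ (f i))) (g := fun _ => 0)
      hsum h (Eventually.of_forall fun g i => by
        rw [Real.norm_of_nonneg measureReal_nonneg]
        exact hle g i)
    rw [tsum_zero] at h1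
    refine squeeze_zero (fun _ => measureReal_nonneg) (fun g => ?_) h1
    have hs : Summable fun i => μ.real ((rmul3 g ⁻¹' (f i)) ∆ (f i)) :=
      Summable.of_nonneg_of_le (fun _ => measureReal_nonneg) (hle g) hsum
    have hsub : (rmul3 g ⁻¹' (⋃ i, f i)) ∆ (⋃ i, f i) ⊆ ⋃ i, (rmul3 g ⁻¹' (f i)) ∆ (f i) := by
      rw [Set.preimage_iUnion]
      intro y hy
      simp only [Set.mem_symmDiff, Set.mem_iUnion] at hy ⊢
      rcases hy with ⟨⟨i, hi⟩, h2⟩ | ⟨⟨i, hi⟩, h2⟩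
      · exact ⟨i, Or.inl ⟨hi, fun h3 => h2 ⟨i, h3⟩⟩⟩
      · exact ⟨i, Or.inr ⟨hi, fun h3 => h2 ⟨i, h3⟩⟩⟩
    have h2 : μ ((rmul3 g ⁻¹' (⋃ i, f i)) ∆ (⋃ i, f i)) ≤
        ∑' i, ENNReal.ofReal (μ.real ((rmul3 g ⁻¹' (f i)) ∆ (f i))) := by
      refine (measure_mono hsub).trans ((measure_iUnion_le _).trans (le_of_eq ?_))
      congr 1
      ext i
      rw [ofReal_measureReal]
    rw [← ENNReal.ofReal_tsum_of_nonneg (fun _ => measureReal_nonneg) hs] at h2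
    exact ENNReal.toReal_le_of_le_ofReal (tsum_nonneg fun _ => measureReal_nonneg) h2

theorem rho_tendsto (hμinv : ∀ g : SL3R, Measure.map (rmul3 g) μ = μ) (v : Lp ℝ 2 μ) :
    Tendsto (fun g => rho hμinv g v) (𝓝 1) (𝓝 v) := by
  refine Lp.induction (p := 2) (by norm_num)
    (fun v : Lp ℝ 2 μ => Tendsto (fun g => rho hμinv g v) (𝓝 1) (𝓝 v)) ?_ ?_ ?_ v
  · intro c s hs hμs
    have h := symmDiff_tendsto hμinv hs
    have h' : Tendsto (fun g => μ ((rmul3 g ⁻¹' s) ∆ s)) (𝓝 1) (𝓝 0) := by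
      have := (ENNReal.continuous_ofReal.tendsto 0).comp h
      simpa [Function.comp_def, ofReal_measureReal] using this
    exact tendsto_indicatorConstLp_set (hs := hs) (hμs := hμs.ne)
      (ht := fun g => (continuous_rmul3_left g).measurable hs)
      (hμt := fun g => measure_ne_top μ _) (by norm_num) h'
  · intro f g hf hg _ h1 h2
    simp only [map_add]
    exact h1.add h2
  · rw [← isSeqClosed_iff_isClosed]
    intro u w hu hw
    rw [Set.mem_ofPred_eq, Metric.tendsto_nhds]
    intro ε hε
    rw [Metric.tendsto_atTop] at hw
    obtain ⟨N, hN⟩ := hw (ε / 3) (by linarith)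
    have h1 := hN N le_rfl
    have h2 := Metric.tendsto_nhds.1 (hu N) (ε / 3) (by linarith)
    filter_upwards [h2] with g hg
    have h3 : dist (rho hμinv g w) (rho hμinv g (u N)) = dist (u N) w := by
      rw [(rho hμinv g).isometry.dist_eq, dist_comm]
    calc dist (rho hμinv g w) w ≤ dist (rho hμinv g w) (rho hμinv g (u N)) +
          dist (rho hμinv g (u N)) (u N) + dist (u N) w := dist_triangle4 _ _ _ _
      _ < ε := by rw [h3]; linarith

theorem rho_continuous (hμinv : ∀ g : SL3R, Measure.map (rmul3 g) μ = μ) (v : Lp ℝ 2 μ) :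
    Continuous fun g => rho hμinv g v := by
  rw [continuous_iff_continuousAt]
  intro g₀
  have h1 : Tendsto (fun g => g₀⁻¹ * g) (𝓝 g₀) (𝓝 1) := by
    have := (continuous_const_mul g₀⁻¹).tendsto g₀
    simpa using this
  have h2 := ((rho hμinv g₀).continuous.tendsto v).comp ((rho_tendsto hμinv v).comp h1)
  refine h2.congr fun g => ?_
  simp only [Function.comp_apply]
  rw [← li_mul_apply, ← map_mul]
  simp

/-- The constant function `1` in `L²`. -/
def oneL (μ : Measure X3) [IsProbabilityMeasure μ] : Lp ℝ 2 μ :=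
  indicatorConstLp 2 MeasurableSet.univ (measure_ne_top μ _) (1 : ℝ)

theorem inv_const (hμinv : ∀ g : SL3R, Measure.map (rmul3 g) μ = μ) (v : Lp ℝ 2 μ)
    (hv : ∀ g, rho hμinv g v = v) : ∃ c : ℝ, v = c • oneL μ := by
  have hF : Measurable (v : X3 → ℝ) := (Lp.stronglyMeasurable v).measurable
  let S : Set (X3 × SL3R) := {p | v (rmul3 p.2 p.1) ≠ v p.1}
  have hS : MeasurableSet S :=
    (measurableSet_eq_fun (hF.comp measurable_rmul3) (hF.comp measurable_fst)).compl
  have h0 : (μ.prod mG) S = 0 := by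
    rw [Measure.prod_apply_symm hS]
    refine (lintegral_congr fun g => ?_).trans lintegral_zero
    have h1 := rho_coeFn hμinv g v
    rw [hv g] at h1
    have h2 : ∀ᵐ y ∂μ, ¬ (v (rmul3 g y) ≠ v y) := by
      filter_upwards [h1] with y hy
      simpa using hy.symm
    rw [ae_iff] at h2
    simpa [S] using h2
  rw [Measure.measure_prod_null hS] at h0
  obtain ⟨y, hy⟩ := h0.exists
  obtain ⟨k, rfl⟩ := proj3_surjective y
  set c := v (proj3 k) with hc
  refine ⟨c, ?_⟩
  have hA : MeasurableSet {y | v y ≠ c} := (measurableSet_eq_fun hF measurable_const).compl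
  have h3 : mG (proj3 ⁻¹' {y | v y ≠ c}) = 0 := by
    rw [← measure_preimage_mul mG k]
    exact hy
  rw [← null_iff hμinv hA] at h3
  have h4 : ∀ᵐ y ∂μ, v y = c := by
    rw [ae_iff]
    exact h3
  apply Lp.ext
  filter_upwards [h4, Lp.coeFn_smul c (oneL μ),
    indicatorConstLp_coeFn (p := 2) (hs := MeasurableSet.univ) (hμs := measure_ne_top μ Set.univ)
      (c := (1 : ℝ))] with y e1 e2 e3
  rw [e1, e2, Pi.smul_apply, oneL, e3]
  simp

theorem inner_oneL (v : Lp ℝ 2 μ) : inner ℝ v (oneL μ) = ∫ y, v y ∂μ := by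
  rw [real_inner_comm, oneL, L2.inner_indicatorConstLp_one]
  simp

theorem mixing (hμinv : ∀ g : SL3R, Measure.map (rmul3 g) μ = μ) (v w : Lp ℝ 2 μ) :
    Tendsto (fun T => inner ℝ (rho hμinv (amat (-T)) v) w) atTop
      (𝓝 ((∫ y, v y ∂μ) * ∫ y, w y ∂μ)) := by
  rw [tendsto_iff_ultrafilter]
  intro F hF
  obtain ⟨v₀, hinv, hlim⟩ := weak_limit (rho hμinv) (rho_continuous hμinv) v F hF
  obtain ⟨c, rfl⟩ := inv_const hμinv v₀ hinv
  have hone : ∀ g, rho hμinv g (oneL μ) = oneL μ := fun g => rfl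
  have h1 := hlim (oneL μ)
  have h2 : ∀ T, inner ℝ (rho hμinv (amat (-T)) v) (oneL μ) = ∫ y, v y ∂μ := by
    intro T
    rw [← inner_oneL]
    conv_lhs => rw [← hone (amat (-T))]
    exact LinearIsometry.inner_map_map _ _ _
  simp_rw [h2] at h1
  have h3 := tendsto_nhds_unique h1 tendsto_const_nhds
  have h4 : inner ℝ (oneL μ) (oneL μ) = (1 : ℝ) := by
    rw [inner_oneL, oneL, integral_indicatorConstLp]
    simp
  rw [inner_smul_left, h4] at h3
  simp only [conj_trivial, mul_one] at h3
  have h5 := hlim w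
  rw [inner_smul_left, h3, real_inner_comm, inner_oneL] at h5
  simpa using h5

end Regular


/-! ### Mixing for `L¹` densities against bounded functions -/

section MixL1

variable {μ : Measure X3} [IsProbabilityMeasure μ]

theorem mixing_L2 (hμinv : ∀ g : SL3R, Measure.map (rmul3 g) μ = μ) {F G : X3 → ℝ}
    (hF : MemLp F 2 μ) (hG : MemLp G 2 μ) :
    Tendsto (fun T => ∫ y, G y * F (rmul3 (amat (-T)) y) ∂μ) atTop
      (𝓝 ((∫ y, G y ∂μ) * ∫ y, F y ∂μ)) := by
  have h := mixing hμinv (hF.toLp F) (hG.toLp G)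
  rw [integral_congr_ae hF.coeFn_toLp, integral_congr_ae hG.coeFn_toLp, mul_comm] at h
  refine h.congr fun T => ?_
  rw [L2.inner_def]
  refine integral_congr_ae ?_
  have h1 := rho_coeFn hμinv (amat (-T)) (hF.toLp F)
  have h2 := (mp_rmul3 hμinv (amat (-T))).quasiMeasurePreserving.ae_eq_comp hF.coeFn_toLp
  filter_upwards [h1, h2, hG.coeFn_toLp] with y e1 e2 e3
  rw [e1, e2, e3]
  simp

theorem mixing_L1 (hμinv : ∀ g : SL3R, Measure.map (rmul3 g) μ = μ) {F G : X3 → ℝ}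
    (hF : Measurable F) {C : ℝ} (hC : ∀ y, |F y| ≤ C) (hG : Integrable G μ) :
    Tendsto (fun T => ∫ y, G y * F (rmul3 (amat (-T)) y) ∂μ) atTop
      (𝓝 ((∫ y, G y ∂μ) * ∫ y, F y ∂μ)) := by
  have hC0 : 0 ≤ C := by
    obtain ⟨y⟩ : Nonempty X3 := ⟨proj3 1⟩
    exact (abs_nonneg _).trans (hC y)
  have hFL : MemLp F 2 μ := MemLp.of_bound hF.aestronglyMeasurable C
    (Eventually.of_forall hC)
  rw [Metric.tendsto_nhds]
  intro ε hε
  set η : ℝ := ε / (3 * (C + 1)) with hη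
  have hη0 : 0 < η := by positivity
  have hCη : η * C ≤ ε / 3 := by
    rw [hη, div_mul_eq_mul_div, div_le_div_iff₀ (by positivity) (by positivity)]
    nlinarith
  obtain ⟨S, hS, hS1⟩ := (memLp_one_iff_integrable.2 hG).exists_simpleFunc_eLpNorm_sub_lt
    (by simp) (ε := ENNReal.ofReal η) (by simpa using hη0)
  have hS2 : MemLp S 2 μ := by
    obtain ⟨B, hB⟩ := S.exists_forall_norm_le
    exact MemLp.of_bound S.aestronglyMeasurable B (Eventually.of_forall hB)
  have hSi : Integrable S μ := memLp_one_iff_integrable.1 hS1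
  have hL1 : ∫ y, |G y - S y| ∂μ < η := by
    rw [eLpNorm_one_eq_lintegral_enorm,
      ← ofReal_integral_norm_eq_lintegral_enorm (hG.sub hSi)] at hS
    exact (ENNReal.ofReal_lt_ofReal_iff hη0).1 hS
  have key : ∀ H : X3 → ℝ, Measurable H → (∀ y, |H y| ≤ C) →
      |∫ y, G y * H y ∂μ - ∫ y, S y * H y ∂μ| ≤ ε / 3 := by
    intro H hH hHC
    have i1 : Integrable (fun y => G y * H y) μ :=
      hG.mul_bdd hH.aestronglyMeasurable (Eventually.of_forall hHC)
    have i2 : Integrable (fun y => S y * H y) μ :=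
      hSi.mul_bdd hH.aestronglyMeasurable (Eventually.of_forall hHC)
    rw [← integral_sub i1 i2]
    calc |∫ y, (G y * H y - S y * H y) ∂μ| ≤ ∫ y, |G y * H y - S y * H y| ∂μ :=
          abs_integral_le_integral_abs
      _ ≤ ∫ y, |G y - S y| * C ∂μ := by
          refine integral_mono (i1.sub i2).abs ((hG.sub hSi).abs.mul_const C) fun y => ?_
          simp only [← sub_mul, abs_mul]
          exact mul_le_mul_of_nonneg_left (hHC y) (abs_nonneg _)
      _ = (∫ y, |G y - S y| ∂μ) * C := integral_mul_const _ _
      _ ≤ η * C := mul_le_mul_of_nonneg_right hL1.le hC0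
      _ ≤ ε / 3 := hCη
  have hconst : |(∫ y, G y ∂μ) * ∫ y, F y ∂μ - (∫ y, S y ∂μ) * ∫ y, F y ∂μ| ≤ ε / 3 := by
    have hb : |∫ y, F y ∂μ| ≤ C := by
      have := norm_integral_le_of_norm_le_const (μ := μ) (f := F) (C := C)
        (Eventually.of_forall hC)
      simpa using this
    have := key (fun _ => ∫ y, F y ∂μ) measurable_const (fun _ => hb)
    simpa only [integral_mul_const] using this
  have hm := mixing_L2 hμinv hFL hS2
  rw [Metric.tendsto_nhds] at hm
  filter_upwards [hm (ε / 3) (by positivity)] with T hT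
  have h1 := key (fun y => F (rmul3 (amat (-T)) y))
    (hF.comp (continuous_rmul3_left _).measurable) (fun y => hC _)
  rw [Real.dist_eq] at hT ⊢
  rw [abs_le] at h1 hconst
  rw [abs_lt] at hT ⊢
  constructor <;> linarith [h1.1, h1.2, hT.1, hT.2, hconst.1, hconst.2]

theorem mixing_ac (hμinv : ∀ g : SL3R, Measure.map (rmul3 g) μ = μ) {F : X3 → ℝ}
    (hF : Measurable F) {C : ℝ} (hC : ∀ y, |F y| ≤ C) (ν : Measure X3) [IsFiniteMeasure ν]
    (hν : ν ≪ μ) :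
    Tendsto (fun T => ∫ y, F (rmul3 (amat (-T)) y) ∂ν) atTop
      (𝓝 (ν.real Set.univ * ∫ y, F y ∂μ)) := by
  have h := mixing_L1 hμinv hF hC (Measure.integrable_toReal_rnDeriv (μ := ν) (ν := μ))
  rw [Measure.integral_toReal_rnDeriv hν] at h
  refine h.congr fun T => ?_
  exact integral_toReal_rnDeriv_mul hν

/-- the measure on `Γ\G` used for the thickening is absolutely continuous -/
theorem thick_ac (hμinv : ∀ g : SL3R, Measure.map (rmul3 g) μ = μ) (h : SL3R) (B : Set SL3R) :
    Measure.map (fun g => proj3 (h * g)) (mG.restrict B) ≪ μ := by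
  have hc : Continuous (fun g => proj3 (h * g)) :=
    proj3_continuous.comp (continuous_const.mul continuous_id)
  refine Measure.AbsolutelyContinuous.mk fun A hA hA0 => ?_
  rw [Measure.map_apply hc.measurable hA]
  refine Measure.absolutelyContinuous_of_le Measure.restrict_le_self ?_
  rw [null_iff hμinv hA] at hA0
  have := measure_preimage_mul mG h (proj3 ⁻¹' A)
  rw [hA0] at this
  exact this

theorem mixing_thick (hμinv : ∀ g : SL3R, Measure.map (rmul3 g) μ = μ) {F : X3 → ℝ}
    (hF : Measurable F) {C : ℝ} (hC : ∀ y, |F y| ≤ C) (h : SL3R) {B : Set SL3R}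
    (hB : mG B ≠ ⊤) :
    Tendsto (fun T => ∫ g in B, F (proj3 (h * g * amat (-T))) ∂mG) atTop
      (𝓝 (mG.real B * ∫ y, F y ∂μ)) := by
  have hc : Continuous (fun g => proj3 (h * g)) :=
    proj3_continuous.comp (continuous_const.mul continuous_id)
  have : IsFiniteMeasure (mG.restrict B) := ⟨by simpa using hB.lt_top⟩
  have h1 := mixing_ac hμinv hF hC _ (thick_ac hμinv h B)
  rw [map_measureReal_apply hc.measurable MeasurableSet.univ] at h1
  simp only [Set.preimage_univ, measureReal_restrict_apply_univ] at h1
  refine h1.congr fun T => ?_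
  exact integral_map hc.measurable.aemeasurable
    (hF.comp (continuous_rmul3_left (amat (-T))).measurable).aestronglyMeasurable

end MixL1


/-! ### Thickening in the stable direction -/

section Thick

/-- Entrywise neighbourhoods of the identity in `SL(3,ℝ)`. -/
def Nb (δ : ℝ) : Set SL3R := {g | ∀ i j, |g i j - (1 : SL3R) i j| < δ}

theorem Nb_open (δ : ℝ) : IsOpen (Nb δ) := by
  have : Nb δ = ⋂ i, ⋂ j, {g : SL3R | |g i j - (1 : SL3R) i j| < δ} := by
    ext g; simp [Nb]
  rw [this]
  exact isOpen_iInter_of_finite fun i => isOpen_iInter_of_finite fun j =>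
    isOpen_lt ((continuous_sl3_apply i j).sub continuous_const).abs continuous_const

theorem one_mem_Nb {δ : ℝ} (hδ : 0 < δ) : (1 : SL3R) ∈ Nb δ := fun i j => by simpa using hδ

theorem Nb_basis {N : Set SL3R} (hN : N ∈ 𝓝 (1 : SL3R)) : ∃ ε > 0, Nb ε ⊆ N := by
  have hN' := hN
  have e : 𝓝 (1 : SL3R) = comap (Subtype.val : SL3R → Matrix (Fin 3) (Fin 3) ℝ)
      (𝓝 (1 : SL3R).1) := sl3_isEmbedding.toIsInducing.nhds_eq_comap (1 : SL3R)
  rw [e] at hN'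
  obtain ⟨t, ht, htN⟩ := mem_comap.1 hN'
  have ht' : t ∈ 𝓝 (fun i j => (1 : SL3R) i j : Fin 3 → Fin 3 → ℝ) := ht
  obtain ⟨ε, hε, hb⟩ := Metric.mem_nhds_iff.1 ht'
  refine ⟨ε, hε, fun g hg => htN (hb ?_)⟩
  have key : ∀ p q : Fin 3 → Fin 3 → ℝ, (∀ i j, |p i j - q i j| < ε) →
      p ∈ Metric.ball q ε := by
    intro p q h
    rw [Metric.mem_ball, dist_pi_lt_iff hε]
    intro i
    rw [dist_pi_lt_iff hε]
    intro j
    rw [Real.dist_eq]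
    exact h i j
  exact key _ _ hg

theorem nmat_mul (x y u v : ℝ) : nmat x y * nmat u v = nmat (x + u) (y + v) := by
  ext i j
  rw [Matrix.SpecialLinearGroup.coe_mul, Matrix.mul_apply, Fin.sum_univ_three]
  fin_cases i <;> fin_cases j <;> simp [nmat]

theorem continuous_nmat : Continuous fun p : ℝ × ℝ => nmat p.1 p.2 := by
  refine continuous_sl3 fun i j => ?_
  fin_cases i <;> fin_cases j <;> simp [nmat] <;> fun_prop

theorem conj_Nb {δ : ℝ} {q : SL3R} (hq : q ∈ Nb δ) (h1 : q 1 0 = 0) (h2 : q 2 0 = 0)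
    {T : ℝ} (hT : 0 ≤ T) : amat T * q * amat (-T) ∈ Nb δ := by
  intro i j
  rw [amat_conj_apply, neg_mul]
  refine lt_of_le_of_lt ?_ (hq i j)
  have e1 : Real.exp (-(2 * T)) * Real.exp (2 * T) = 1 := by rw [← Real.exp_add]; simp
  have e2 : Real.exp T * Real.exp (-T) = 1 := by rw [← Real.exp_add]; simp
  have e3 : Real.exp (-(2 * T)) * Real.exp (-T) ≤ 1 := by
    rw [← Real.exp_add, Real.exp_le_one_iff]; linarith
  have e3' : 0 ≤ Real.exp (-(2 * T)) * Real.exp (-T) := by positivity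
  have k1 : ∀ a b x : ℝ, a * b = 1 → a * x * b = x := fun a b x h => by
    rw [mul_right_comm, h, one_mul]
  have k2 : ∀ x : ℝ, |Real.exp (-(2 * T)) * x * Real.exp (-T)| ≤ |x| := fun x => by
    rw [mul_right_comm, abs_mul, abs_of_nonneg e3']
    exact mul_le_of_le_one_left (abs_nonneg _) e3
  fin_cases i <;> fin_cases j <;>
    simp [k1 _ _ _ e1, k1 _ _ _ e2, h1, h2, -abs_mul] <;> exact k2 _

theorem thick_nhds {δ : ℝ} (hδ : 0 < δ) : ∃ B : Set SL3R, IsOpen B ∧ (1 : SL3R) ∈ B ∧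
    mG B ≠ ⊤ ∧ ∀ g ∈ B, ∃ u : ℝ × ℝ, |u.1| < δ ∧ |u.2| < δ ∧
      ∀ T : ℝ, 0 ≤ T → ∃ s ∈ Nb δ, ∀ x : ℝ × ℝ,
        rmul3 s (proj3 (nmat x.1 x.2 * g * amat (-T))) =
          proj3 (nmat (x + u).1 (x + u).2 * amat (-T)) := by
  have c00 : ContinuousAt (fun g : SL3R => g 0 0) 1 := (continuous_sl3_apply 0 0).continuousAt
  have h00 : (1 : SL3R) 0 0 ≠ 0 := by simp
  have cu : ContinuousAt (fun g : SL3R => (g 1 0 / g 0 0, g 2 0 / g 0 0)) 1 :=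
    ((continuous_sl3_apply 1 0).continuousAt.div c00 h00).prodMk
      ((continuous_sl3_apply 2 0).continuousAt.div c00 h00)
  have cq : ContinuousAt (fun g : SL3R => g⁻¹ * nmat (g 1 0 / g 0 0) (g 2 0 / g 0 0)) 1 :=
    continuousAt_inv.mul (continuous_nmat.continuousAt.comp cu)
  have n00 : nmat 0 0 = 1 := by
    ext i j
    fin_cases i <;> fin_cases j <;> simp [nmat]
  have ev1 : ∀ᶠ g : SL3R in 𝓝 1, g 0 0 ≠ 0 := c00.eventually_ne h00
  have ev2 : ∀ᶠ g : SL3R in 𝓝 1, |g 1 0 / g 0 0| < δ := by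
    refine cu.fst.abs.eventually (gt_mem_nhds ?_)
    simpa using hδ
  have ev3 : ∀ᶠ g : SL3R in 𝓝 1, |g 2 0 / g 0 0| < δ := by
    refine cu.snd.abs.eventually (gt_mem_nhds ?_)
    simpa using hδ
  have ev4 : ∀ᶠ g : SL3R in 𝓝 1, g⁻¹ * nmat (g 1 0 / g 0 0) (g 2 0 / g 0 0) ∈ Nb δ := by
    refine cq.eventually_mem ((Nb_open δ).mem_nhds ?_)
    simpa [n00] using one_mem_Nb hδ
  obtain ⟨K, hK, hK1⟩ := exists_compact_mem_nhds (1 : SL3R)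
  have ev := ev1.and (ev2.and (ev3.and (ev4.and hK1)))
  obtain ⟨B, hB, hBo, hB1⟩ := mem_nhds_iff.1 ev
  refine ⟨B, hBo, hB1, ?_, fun g hg => ?_⟩
  · refine ((measure_mono fun g hg => (hB hg).2.2.2.2).trans_lt hK.measure_lt_top).ne
  obtain ⟨g1, g2, g3, g4, -⟩ := hB hg
  refine ⟨(g 1 0 / g 0 0, g 2 0 / g 0 0), g2, g3, fun T hT => ?_⟩
  set q := g⁻¹ * nmat (g 1 0 / g 0 0) (g 2 0 / g 0 0) with hq
  have hcol : ∀ i, q i 0 = (1 : SL3R) i 0 / g 0 0 := by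
    intro i
    rw [← inv_mul_cancel g, hq, Matrix.SpecialLinearGroup.coe_mul,
      Matrix.SpecialLinearGroup.coe_mul, Matrix.mul_apply, Matrix.mul_apply,
      Finset.sum_div]
    refine Finset.sum_congr rfl fun k _ => ?_
    rw [mul_div_assoc]
    congr 1
    fin_cases k <;> simp [nmat, g1]
  refine ⟨amat T * q * amat (-T), conj_Nb g4 (by simp [hcol]) (by simp [hcol]) hT, fun x => ?_⟩
  rw [rmul3_proj3]
  congr 1
  have : amat T = (amat (-T))⁻¹ := by rw [amat_inv, neg_neg]
  rw [this, hq]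
  simp only [Prod.fst_add, Prod.snd_add, ← nmat_mul]
  group

end Thick


/-! ### Lower envelopes and the key lower bound -/

section Key

/-- small displacements -/
def Wb (δ : ℝ) : Set ((ℝ × ℝ) × SL3R) := {w | |w.1.1| < δ ∧ |w.1.2| < δ ∧ w.2 ∈ Nb δ}

/-- lower envelope of `f` at scale `δ` -/
def fd (f : (ℝ × ℝ) × X3 → ℝ) (δ : ℝ) (p : (ℝ × ℝ) × X3) : ℝ :=
  ⨅ w : Wb δ, f (p.1 + w.1.1, rmul3 w.1.2 p.2)

theorem fd_bdd {f : (ℝ × ℝ) × X3 → ℝ} (h0 : ∀ p, 0 ≤ f p) (δ : ℝ) (p : (ℝ × ℝ) × X3) :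
    BddBelow (Set.range fun w : Wb δ => f (p.1 + w.1.1, rmul3 w.1.2 p.2)) :=
  ⟨0, by rintro _ ⟨w, rfl⟩; exact h0 _⟩

theorem fd_nonneg {f : (ℝ × ℝ) × X3 → ℝ} (h0 : ∀ p, 0 ≤ f p) (δ : ℝ) (p : (ℝ × ℝ) × X3) :
    0 ≤ fd f δ p := Real.iInf_nonneg fun _ => h0 _

theorem fd_le {f : (ℝ × ℝ) × X3 → ℝ} (h0 : ∀ p, 0 ≤ f p) {δ : ℝ} (x u : ℝ × ℝ) (s : SL3R)
    (y : X3) (h1 : |u.1| < δ) (h2 : |u.2| < δ) (hs : s ∈ Nb δ) :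
    fd f δ (x, y) ≤ f (x + u, rmul3 s y) :=
  ciInf_le (fd_bdd h0 δ (x, y)) (⟨(u, s), h1, h2, hs⟩ : Wb δ)

theorem fd_le_self {f : (ℝ × ℝ) × X3 → ℝ} (h0 : ∀ p, 0 ≤ f p) {δ : ℝ} (hδ : 0 < δ)
    (p : (ℝ × ℝ) × X3) : fd f δ p ≤ f p := by
  have := fd_le h0 (δ := δ) p.1 0 1 p.2 (by simpa using hδ) (by simpa using hδ) (one_mem_Nb hδ)
  simpa [rmul3_one] using this

theorem fd_measurable {f : (ℝ × ℝ) × X3 → ℝ} (hf : Continuous f) (h0 : ∀ p, 0 ≤ f p) (δ : ℝ) :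
    Measurable (fd f δ) := by
  refine UpperSemicontinuous.measurable ?_
  refine upperSemicontinuous_ciInf (fun p => fd_bdd h0 δ p) fun w => ?_
  refine Continuous.upperSemicontinuous ?_
  exact hf.comp ((continuous_fst.add continuous_const).prodMk
    ((continuous_rmul3_left _).comp continuous_snd))

theorem fd_tendsto {f : (ℝ × ℝ) × X3 → ℝ} (hf : Continuous f) (h0 : ∀ p, 0 ≤ f p)
    {d : ℕ → ℝ} (hd : ∀ n, 0 < d n) (hd0 : Tendsto d atTop (𝓝 0)) (p : (ℝ × ℝ) × X3) :
    Tendsto (fun n => fd f (d n) p) atTop (𝓝 (f p)) := by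
  rw [Metric.tendsto_nhds]
  intro ε hε
  have hc : Continuous fun w : (ℝ × ℝ) × SL3R => f (p.1 + w.1, rmul3 w.2 p.2) :=
    hf.comp ((continuous_const.add continuous_fst).prodMk
      ((continuous_rmul3_right p.2).comp continuous_snd))
  have h1 : ∀ᶠ w : (ℝ × ℝ) × SL3R in 𝓝 ((0 : ℝ × ℝ), (1 : SL3R)),
      f p - ε / 2 < f (p.1 + w.1, rmul3 w.2 p.2) := by
    refine hc.continuousAt.eventually (lt_mem_nhds ?_)
    simp only [add_zero, rmul3_one]
    linarith
  rw [nhds_prod_eq] at h1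
  obtain ⟨U, hU, N, hN, hUN⟩ := Filter.mem_prod_iff.1 h1
  obtain ⟨e1, he1, hU'⟩ := Metric.mem_nhds_iff.1 hU
  obtain ⟨e2, he2, hN'⟩ := Nb_basis hN
  filter_upwards [hd0.eventually (gt_mem_nhds he1), hd0.eventually (gt_mem_nhds he2)] with n n1 n2
  have hne : Nonempty (Wb (d n)) :=
    ⟨⟨(0, 1), by simpa using hd n, by simpa using hd n, one_mem_Nb (hd n)⟩⟩
  have l1 : f p - ε / 2 ≤ fd f (d n) p := by
    refine le_ciInf fun w => le_of_lt (hUN (⟨hU' ?_, hN' ?_⟩ : w.1 ∈ U ×ˢ N))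
    · rw [Metric.mem_ball, dist_zero_right, Prod.norm_def, max_lt_iff]
      exact ⟨w.2.1.trans n1, w.2.2.1.trans n1⟩
    · exact fun i j => (w.2.2.2 i j).trans n2
  have l2 := fd_le_self h0 (hd n) p
  rw [Real.dist_eq, abs_lt]
  constructor <;> linarith

/-- the unit square -/
def Isq : Set (ℝ × ℝ) := Set.Icc (0:ℝ) 1 ×ˢ Set.Icc (0:ℝ) 1

/-- the shrunken square -/
def Jsq (δ : ℝ) : Set (ℝ × ℝ) := Set.Icc δ (1 - δ) ×ˢ Set.Icc δ (1 - δ)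

theorem Isq_meas : MeasurableSet Isq := measurableSet_Icc.prod measurableSet_Icc
theorem Jsq_meas (δ : ℝ) : MeasurableSet (Jsq δ) := measurableSet_Icc.prod measurableSet_Icc

theorem Isq_vol : volume Isq = 1 := by
  rw [Isq, Measure.volume_eq_prod, Measure.prod_prod]; simp

instance : IsProbabilityMeasure (volume.restrict Isq) := ⟨by simp [Isq_vol]⟩

theorem Jsq_sub {δ : ℝ} (hδ : 0 < δ) : Jsq δ ⊆ Isq := by
  rintro x ⟨⟨a, b⟩, c, d⟩
  exact ⟨⟨by linarith, by linarith⟩, by linarith, by linarith⟩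

theorem Jsq_vol {δ : ℝ} (hδ : 0 < δ) : volume (Jsq δ) < ⊤ :=
  (measure_mono (Jsq_sub hδ)).trans_lt (by simp [Isq_vol])

theorem shift_bound {f : (ℝ × ℝ) × X3 → ℝ} (hf : Continuous f) (h0 : ∀ p, 0 ≤ f p) {C : ℝ}
    (hC : ∀ p, f p ≤ C) {δ : ℝ} {g : SL3R} {u : ℝ × ℝ} (hu1 : |u.1| < δ)
    (hu2 : |u.2| < δ) {T : ℝ} {s : SL3R} (hs : s ∈ Nb δ)
    (hx : ∀ x : ℝ × ℝ, rmul3 s (proj3 (nmat x.1 x.2 * g * amat (-T))) =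
          proj3 (nmat (x + u).1 (x + u).2 * amat (-T))) :
    ∫ x in Jsq δ, fd f δ (x, proj3 (nmat x.1 x.2 * g * amat (-T))) ≤
      ∫ x in Isq, f (x, proj3 (nmat x.1 x.2 * amat (-T))) := by
  set h : ℝ × ℝ → ℝ := fun x => f (x, proj3 (nmat x.1 x.2 * amat (-T))) with hh
  have hhc : Continuous h := hf.comp (continuous_id.prodMk
    (proj3_continuous.comp (continuous_nmat.mul continuous_const)))
  have hhm : Measurable h := hhc.measurable
  have e : ∫ x in Isq, h x = ∫ x, Isq.indicator h (x + u) := by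
    rw [integral_add_right_eq_self (Isq.indicator h) u, integral_indicator Isq_meas]
  have hint : Integrable (Isq.indicator h) := by
    rw [integrable_indicator_iff Isq_meas]
    refine Integrable.of_bound hhm.aestronglyMeasurable C (Eventually.of_forall fun x => ?_)
    rw [Real.norm_eq_abs, abs_of_nonneg (h0 _)]
    exact hC _
  rw [e, ← integral_indicator (Jsq_meas δ)]
  refine integral_mono_of_nonneg (Eventually.of_forall fun x => ?_) (hint.comp_add_right u)
    (Eventually.of_forall fun x => ?_)
  · exact Set.indicator_nonneg (fun _ _ => fd_nonneg h0 _ _) _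
  · by_cases hxJ : x ∈ Jsq δ
    · have hxI : x + u ∈ Isq := by
        obtain ⟨⟨a, b⟩, c, d⟩ := hxJ
        rw [abs_lt] at hu1 hu2
        refine ⟨⟨?_, ?_⟩, ?_, ?_⟩ <;> simp only [Prod.fst_add, Prod.snd_add] <;>
          linarith [hu1.1, hu1.2, hu2.1, hu2.2]
      simp only [Set.indicator_of_mem hxJ, Set.indicator_of_mem hxI, hh]
      have := fd_le h0 x u s (proj3 (nmat x.1 x.2 * g * amat (-T))) hu1 hu2 hs
      rwa [hx] at this
    · simp only [Set.indicator_of_notMem hxJ]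
      exact Set.indicator_nonneg (fun _ _ => h0 _) _

variable {μ : Measure X3} [IsProbabilityMeasure μ]

theorem key_delta (hμinv : ∀ g : SL3R, Measure.map (rmul3 g) μ = μ)
    {f : (ℝ × ℝ) × X3 → ℝ} (hf : Continuous f) (h0 : ∀ p, 0 ≤ f p) {C : ℝ}
    (hC : ∀ p, f p ≤ C) {δ : ℝ} (hδ : 0 < δ) {c : ℝ}
    (hc : c < ∫ x in Jsq δ, ∫ y, fd f δ (x, y) ∂μ) :
    ∀ᶠ T in atTop, c < ∫ x in Isq, f (x, proj3 (nmat x.1 x.2 * amat (-T))) := by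
  obtain ⟨B, hBo, hB1, hBfin, hB⟩ := thick_nhds hδ
  have hBpos : 0 < mG.real B :=
    ENNReal.toReal_pos (hBo.measure_pos mG ⟨1, hB1⟩).ne' hBfin
  have fB : IsFiniteMeasure (mG.restrict B) := ⟨by simpa using hBfin.lt_top⟩
  have fJ : IsFiniteMeasure (volume.restrict (Jsq δ)) := ⟨by simpa using Jsq_vol hδ⟩
  have hm := fd_measurable hf h0 δ
  have hb : ∀ p, |fd f δ p| ≤ C := fun p => by
    rw [abs_of_nonneg (fd_nonneg h0 _ _)]
    exact (fd_le_self h0 hδ p).trans (hC p)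
  have hcont : ∀ T : ℝ, Measurable fun q : (ℝ × ℝ) × SL3R =>
      (q.1, proj3 (nmat q.1.1 q.1.2 * q.2 * amat (-T))) := fun T =>
    measurable_fst.prodMk (proj3_continuous.comp (((continuous_nmat.comp continuous_fst).mul
      continuous_snd).mul continuous_const)).measurable
  have hm2 : ∀ T : ℝ, Measurable fun q : (ℝ × ℝ) × SL3R =>
      fd f δ (q.1, proj3 (nmat q.1.1 q.1.2 * q.2 * amat (-T))) := fun T => hm.comp (hcont T)
  have swap : ∀ T : ℝ, ∫ g in B, (∫ x in Jsq δ,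
      fd f δ (x, proj3 (nmat x.1 x.2 * g * amat (-T)))) ∂mG =
      ∫ x in Jsq δ, ∫ g in B, fd f δ (x, proj3 (nmat x.1 x.2 * g * amat (-T))) ∂mG := by
    intro T
    refine (integral_integral_swap (f := fun x g =>
      fd f δ (x, proj3 (nmat x.1 x.2 * g * amat (-T)))) ?_).symm
    exact Integrable.of_bound (hm2 T).aestronglyMeasurable C (Eventually.of_forall fun q => hb _)
  have lim : Tendsto (fun T : ℝ => ∫ x in Jsq δ, ∫ g in B,
      fd f δ (x, proj3 (nmat x.1 x.2 * g * amat (-T))) ∂mG) atTop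
      (𝓝 (∫ x in Jsq δ, mG.real B * ∫ y, fd f δ (x, y) ∂μ)) := by
    refine tendsto_integral_filter_of_dominated_convergence (fun _ => C * mG.real B) ?_ ?_
      (integrable_const _) ?_
    · refine Eventually.of_forall fun T => ?_
      exact ((hm2 T).stronglyMeasurable.integral_prod_right' (ν := mG.restrict B)).aestronglyMeasurable
    · refine Eventually.of_forall fun T => Eventually.of_forall fun x => ?_
      have := norm_integral_le_of_norm_le_const (μ := mG.restrict B) (C := C)
        (f := fun g => fd f δ (x, proj3 (nmat x.1 x.2 * g * amat (-T))))
        (Eventually.of_forall fun g => hb _)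
      simpa using this
    · refine Eventually.of_forall fun x => ?_
      exact mixing_thick hμinv (F := fun y => fd f δ (x, y))
        (hm.comp measurable_prodMk_left) (fun y => hb _) (nmat x.1 x.2) hBfin
  rw [integral_const_mul] at lim
  have ev := lim.eventually (lt_mem_nhds (mul_lt_mul_of_pos_left hc hBpos))
  filter_upwards [ev, eventually_ge_atTop 0] with T hT hT0
  refine lt_of_mul_lt_mul_left (hT.trans_le ?_) hBpos.le
  rw [← swap T]
  have hle : ∀ g ∈ B, ∫ x in Jsq δ, fd f δ (x, proj3 (nmat x.1 x.2 * g * amat (-T))) ≤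
      ∫ x in Isq, f (x, proj3 (nmat x.1 x.2 * amat (-T))) := by
    intro g hg
    obtain ⟨u, u1, u2, hu⟩ := hB g hg
    obtain ⟨s, hs, hx⟩ := hu T hT0
    exact shift_bound hf h0 hC u1 u2 hs hx
  calc ∫ g in B, (∫ x in Jsq δ, fd f δ (x, proj3 (nmat x.1 x.2 * g * amat (-T)))) ∂mG
      ≤ ∫ g in B, (∫ x in Isq, f (x, proj3 (nmat x.1 x.2 * amat (-T)))) ∂mG := by
        refine integral_mono_of_nonneg (Eventually.of_forall fun g =>
          integral_nonneg fun x => fd_nonneg h0 _ _) (integrable_const _) ?_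
        exact (ae_restrict_iff' hBo.measurableSet).2 (Eventually.of_forall hle)
    _ = mG.real B * ∫ x in Isq, f (x, proj3 (nmat x.1 x.2 * amat (-T))) := by
        simp

theorem key_lower (hμinv : ∀ g : SL3R, Measure.map (rmul3 g) μ = μ)
    {f : (ℝ × ℝ) × X3 → ℝ} (hf : Continuous f) (h0 : ∀ p, 0 ≤ f p) {C : ℝ}
    (hC : ∀ p, f p ≤ C) {c : ℝ} (hc : c < ∫ x in Isq, ∫ y, f (x, y) ∂μ) :
    ∀ᶠ T in atTop, c < ∫ x in Isq, f (x, proj3 (nmat x.1 x.2 * amat (-T))) := by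
  set d : ℕ → ℝ := fun n => 1 / ((n : ℝ) + 1) with hd
  have hdp : ∀ n, 0 < d n := fun n => by positivity
  have hd0 : Tendsto d atTop (𝓝 0) := tendsto_one_div_add_atTop_nhds_zero_nat
  have hb : ∀ n p, |fd f (d n) p| ≤ C := fun n p => by
    rw [abs_of_nonneg (fd_nonneg h0 _ _)]
    exact (fd_le_self h0 (hdp n) p).trans (hC p)
  have hC0 : 0 ≤ C := (h0 (0, proj3 1)).trans (hC _)
  have hm := fun n => fd_measurable hf h0 (d n)
  have inner : ∀ x, Tendsto (fun n => ∫ y, fd f (d n) (x, y) ∂μ) atTop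
      (𝓝 (∫ y, f (x, y) ∂μ)) := by
    intro x
    refine tendsto_integral_of_dominated_convergence (fun _ => C) ?_ (integrable_const _) ?_ ?_
    · exact fun n => ((hm n).comp measurable_prodMk_left).aestronglyMeasurable
    · exact fun n => Eventually.of_forall fun y => hb _ _
    · exact Eventually.of_forall fun y => fd_tendsto hf h0 hdp hd0 (x, y)
  have hae : ∀ᵐ x ∂(volume.restrict Isq), x ∈ Set.Ioo (0:ℝ) 1 ×ˢ Set.Ioo (0:ℝ) 1 := by
    have : (Set.Ioo (0:ℝ) 1 ×ˢ Set.Ioo (0:ℝ) 1 : Set (ℝ × ℝ)) =ᵐ[volume] Isq :=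
      Measure.set_prod_ae_eq Ioo_ae_eq_Icc Ioo_ae_eq_Icc
    rw [← Measure.restrict_congr_set this]
    exact ae_restrict_mem (measurableSet_Ioo.prod measurableSet_Ioo)
  have lim : Tendsto (fun n => ∫ x in Isq,
      (Jsq (d n)).indicator (fun x => ∫ y, fd f (d n) (x, y) ∂μ) x) atTop
      (𝓝 (∫ x in Isq, ∫ y, f (x, y) ∂μ)) := by
    refine tendsto_integral_of_dominated_convergence (fun _ => C) ?_ (integrable_const _) ?_ ?_
    · exact fun n => (((hm n).stronglyMeasurable.integral_prod_right'
        (ν := μ)).indicator (Jsq_meas _)).aestronglyMeasurable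
    · refine fun n => Eventually.of_forall fun x => ?_
      refine (norm_indicator_le_norm_self _ _).trans ?_
      have := norm_integral_le_of_norm_le_const (μ := μ) (C := C)
        (f := fun y => fd f (d n) (x, y)) (Eventually.of_forall fun g => hb _ _)
      simpa using this
    · filter_upwards [hae] with x hx
      refine (inner x).congr' ?_
      obtain ⟨⟨a1, a2⟩, b1, b2⟩ := hx
      filter_upwards [hd0.eventually (gt_mem_nhds a1), hd0.eventually (gt_mem_nhds b1),
        hd0.eventually (gt_mem_nhds (sub_pos.2 a2)),
        hd0.eventually (gt_mem_nhds (sub_pos.2 b2))] with n n1 n2 n3 n4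
      rw [Set.indicator_of_mem]
      exact ⟨⟨n1.le, by linarith⟩, n2.le, by linarith⟩
  obtain ⟨n, hn⟩ := (lim.eventually (lt_mem_nhds hc)).exists
  refine key_delta hμinv hf h0 hC (hdp n) (hn.trans_eq ?_)
  rw [setIntegral_indicator (Jsq_meas _), Set.inter_eq_right.2 (Jsq_sub (hdp n))]

end Key

/-- **Equidistribution of expanding translates of the closed horosphere `Γ N`**
(Theorem `horosphereequidistribution`):  for every Borel probability measure `μ` on
`Γ \ G` invariant under the right `G`-action (the normalized Haar measure) and every
bounded continuous `f : 𝕋² × Γ\G → ℝ` (identified with a `ℤ²`-periodic function on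
`ℝ² × Γ\G`),
`lim_{T → ∞} ∫_{[0,1]²} f(x, Γ n(x) a(-T)) dx = ∫_{[0,1]²} ∫_{Γ\G} f(x, g) dμ(g) dx`. -/
theorem horosphere_equidistribution
    (μ : Measure X3) [IsProbabilityMeasure μ]
    (hμinv : ∀ g : SL3R, Measure.map (rmul3 g) μ = μ)
    (f : (ℝ × ℝ) × X3 → ℝ)
    (hf_cont : Continuous f)
    (hf_bdd : ∃ C : ℝ, ∀ p, |f p| ≤ C)
    (hf_per : ∀ (x : ℝ × ℝ) (k : ℤ × ℤ) (y : X3),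
      f ((x.1 + (k.1 : ℝ), x.2 + (k.2 : ℝ)), y) = f (x, y)) :
    Tendsto
      (fun T : ℝ =>
        ∫ x in (Set.Icc (0:ℝ) 1) ×ˢ (Set.Icc (0:ℝ) 1),
          f (x, proj3 (nmat x.1 x.2 * amat (-T))))
      atTop
      (𝓝 (∫ x in (Set.Icc (0:ℝ) 1) ×ˢ (Set.Icc (0:ℝ) 1), ∫ y, f (x, y) ∂μ)) := by
  obtain ⟨C, hC⟩ := hf_bdd
  have hmeas : ∀ T : ℝ, Continuous fun x : ℝ × ℝ => f (x, proj3 (nmat x.1 x.2 * amat (-T))) :=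
    fun T => hf_cont.comp (continuous_id.prodMk
      (proj3_continuous.comp (continuous_nmat.mul continuous_const)))
  have i1 : ∀ T : ℝ, Integrable (fun x : ℝ × ℝ => f (x, proj3 (nmat x.1 x.2 * amat (-T))))
      (volume.restrict Isq) := fun T =>
    Integrable.of_bound (hmeas T).measurable.aestronglyMeasurable C
      (Eventually.of_forall fun x => hC _)
  have i2 : ∀ x, Integrable (fun y => f (x, y)) μ := fun x =>
    Integrable.of_bound (hf_cont.measurable.comp measurable_prodMk_left).aestronglyMeasurable C
      (Eventually.of_forall fun y => hC _)
  have i3 : Integrable (fun x => ∫ y, f (x, y) ∂μ) (volume.restrict Isq) := by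
    refine Integrable.of_bound hf_cont.measurable.stronglyMeasurable.integral_prod_right'.aestronglyMeasurable
      C (Eventually.of_forall fun x => ?_)
    have := norm_integral_le_of_norm_le_const (μ := μ) (C := C)
      (f := fun y => f (x, y)) (Eventually.of_forall fun g => hC _)
    simpa using this
  change Tendsto (fun T : ℝ => ∫ x in Isq, f (x, proj3 (nmat x.1 x.2 * amat (-T)))) atTop
    (𝓝 (∫ x in Isq, ∫ y, f (x, y) ∂μ))
  have up : ∀ c < (∫ x in Isq, ∫ y, f (x, y) ∂μ), ∀ᶠ T in atTop,
      c < ∫ x in Isq, f (x, proj3 (nmat x.1 x.2 * amat (-T))) := by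
    intro c hc
    have e : ∫ x in Isq, ∫ y, (f (x, y) + C) ∂μ = (∫ x in Isq, ∫ y, f (x, y) ∂μ) + C := by
      simp_rw [integral_add (i2 _) (integrable_const C)]
      rw [integral_add i3 (integrable_const _)]
      simp
    have := key_lower hμinv (f := fun p => f p + C) (hf_cont.add continuous_const)
      (fun p => by linarith [(abs_le.1 (hC p)).1]) (C := 2 * C)
      (fun p => by linarith [(abs_le.1 (hC p)).2]) (c := c + C) (by rw [e]; linarith)
    filter_upwards [this] with T hT
    rw [integral_add (i1 T) (integrable_const _)] at hT
    simp only [integral_const, probReal_univ, one_smul] at hT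
    linarith
  have low : ∀ c > (∫ x in Isq, ∫ y, f (x, y) ∂μ), ∀ᶠ T in atTop,
      ∫ x in Isq, f (x, proj3 (nmat x.1 x.2 * amat (-T))) < c := by
    intro c hc
    have e : ∫ x in Isq, ∫ y, (C - f (x, y)) ∂μ = C - (∫ x in Isq, ∫ y, f (x, y) ∂μ) := by
      simp_rw [integral_sub (integrable_const C) (i2 _)]
      rw [integral_sub (integrable_const _) i3]
      simp
    have := key_lower hμinv (f := fun p => C - f p) (continuous_const.sub hf_cont)
      (fun p => by linarith [(abs_le.1 (hC p)).2]) (C := 2 * C)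
      (fun p => by linarith [(abs_le.1 (hC p)).1]) (c := C - c) (by rw [e]; linarith)
    filter_upwards [this] with T hT
    rw [integral_sub (integrable_const _) (i1 T)] at hT
    simp only [integral_const, probReal_univ, one_smul] at hT
    linarith
  exact tendsto_order.2 ⟨up, low⟩
end
end

section
/- Assume ℤ[α] is integrally closed (the maximal order of ℚ(α)). Let m₁, m₂ be positive integers and μ₁, μ₂, λ ∈ ℤ with F(μ₁) ≡ 0 (mod m₁) and F(μ₂) ≡ 0 (mod m₂). If the ℤ-submodule of ℤ[α] spanned by {α² + (μ₁ + a₁)α + λ, m₁α − μ₂m₁, m₁m₂} is an ideal of ℤ[α] (closed under multiplication by α), then gcd(m₁, m₂, μ₁ − μ₂) = 1. -/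
open Polynomial

noncomputable section

/-- The cubic polynomial `F(X) = X³ + a₁X² + a₂X + a₃ ∈ ℤ[X]`. -/
def Fcubic (a₁ a₂ a₃ : ℤ) : ℤ[X] := X ^ 3 + C a₁ * X ^ 2 + C a₂ * X + C a₃

/-- The ring `ℤ[α] = ℤ[X]/(F(X))`. -/
abbrev Zalpha (a₁ a₂ a₃ : ℤ) := AdjoinRoot (Fcubic a₁ a₂ a₃)

/-- `α`, the image of `X` in `ℤ[α]`. -/
def alphaRoot (a₁ a₂ a₃ : ℤ) : Zalpha a₁ a₂ a₃ := AdjoinRoot.root (Fcubic a₁ a₂ a₃)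

/-- The `ℤ`-submodule of `ℤ[α]` spanned by
`{α² + (μ₁ + a₁)α + λ, m₁α - μ₂m₁, m₁m₂}`. -/
def idealSpan (a₁ a₂ a₃ m₁ m₂ μ₁ μ₂ lam : ℤ) : Submodule ℤ (Zalpha a₁ a₂ a₃) :=
  Submodule.span ℤ
    ({alphaRoot a₁ a₂ a₃ ^ 2 + ((μ₁ + a₁ : ℤ) : Zalpha a₁ a₂ a₃) * alphaRoot a₁ a₂ a₃ +
        (lam : Zalpha a₁ a₂ a₃),
      (m₁ : Zalpha a₁ a₂ a₃) * alphaRoot a₁ a₂ a₃ - ((μ₂ * m₁ : ℤ) : Zalpha a₁ a₂ a₃),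
      ((m₁ * m₂ : ℤ) : Zalpha a₁ a₂ a₃)} : Set (Zalpha a₁ a₂ a₃))

theorem Fc_monic (a₁ a₂ a₃ : ℤ) : (Fcubic a₁ a₂ a₃).Monic := by
  unfold Fcubic; monicity!

theorem Fc_deg (a₁ a₂ a₃ : ℤ) : (Fcubic a₁ a₂ a₃).natDegree = 3 := by
  unfold Fcubic; compute_degree!

theorem alpha_rel (a₁ a₂ a₃ : ℤ) :
    alphaRoot a₁ a₂ a₃ ^ 3 + (a₁ : Zalpha a₁ a₂ a₃) * alphaRoot a₁ a₂ a₃ ^ 2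
      + (a₂ : Zalpha a₁ a₂ a₃) * alphaRoot a₁ a₂ a₃ + (a₃ : Zalpha a₁ a₂ a₃) = 0 := by
  have h : AdjoinRoot.mk (Fcubic a₁ a₂ a₃) (Fcubic a₁ a₂ a₃) = 0 := AdjoinRoot.mk_self
  conv at h => lhs; arg 2; unfold Fcubic
  simpa [alphaRoot] using h

theorem coord_zero (a₁ a₂ a₃ u v w : ℤ)
    (h : (w : Zalpha a₁ a₂ a₃) * alphaRoot a₁ a₂ a₃ ^ 2
      + (v : Zalpha a₁ a₂ a₃) * alphaRoot a₁ a₂ a₃ + (u : Zalpha a₁ a₂ a₃) = 0) :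
    w = 0 ∧ v = 0 ∧ u = 0 := by
  have h' : AdjoinRoot.mk (Fcubic a₁ a₂ a₃) (C w * X ^ 2 + C v * X + C u) = 0 := by
    simpa [alphaRoot] using h
  rw [AdjoinRoot.mk_eq_zero] at h'
  have h0 : (C w * X ^ 2 + C v * X + C u : ℤ[X]) = 0 := by
    by_contra hne
    have h1 := Polynomial.natDegree_le_of_dvd h' hne
    rw [Fc_deg] at h1
    have h2 := Polynomial.natDegree_quadratic_le (a := w) (b := v) (c := u)
    omega
  refine ⟨?_, ?_, ?_⟩
  · simpa [coeff_X, coeff_C, -eq_intCast, -map_intCast] using congrArg (fun q => coeff q 2) h0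
  · simpa [coeff_X, coeff_C, -eq_intCast, -map_intCast] using congrArg (fun q => coeff q 1) h0
  · simpa [coeff_X, coeff_C, -eq_intCast, -map_intCast] using congrArg (fun q => coeff q 0) h0

theorem coord_exists (a₁ a₂ a₃ : ℤ) (y : Zalpha a₁ a₂ a₃) :
    ∃ u v w : ℤ, y = (w : Zalpha a₁ a₂ a₃) * alphaRoot a₁ a₂ a₃ ^ 2
      + (v : Zalpha a₁ a₂ a₃) * alphaRoot a₁ a₂ a₃ + (u : Zalpha a₁ a₂ a₃) := by
  obtain ⟨g, rfl⟩ := AdjoinRoot.mk_surjective y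
  have hm := Fc_monic a₁ a₂ a₃
  set r := g %ₘ Fcubic a₁ a₂ a₃ with hr
  have hdeg : r.natDegree < 3 := by
    have := Polynomial.natDegree_modByMonic_lt g hm (by
      intro h; have := Fc_deg a₁ a₂ a₃; rw [h] at this; simp at this)
    rwa [Fc_deg] at this
  have e1 : AdjoinRoot.mk (Fcubic a₁ a₂ a₃) g = AdjoinRoot.mk (Fcubic a₁ a₂ a₃) r := by
    conv_lhs => rw [← Polynomial.modByMonic_add_div g (Fcubic a₁ a₂ a₃)]
    simp [hr]
  refine ⟨r.coeff 0, r.coeff 1, r.coeff 2, ?_⟩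
  rw [e1]
  conv_lhs => rw [r.as_sum_range' 3 hdeg]
  simp only [Finset.sum_range_succ, Finset.sum_range_zero, ← C_mul_X_pow_eq_monomial]
  simp [alphaRoot]
  ring

theorem span_coord {a₁ a₂ a₃ m₁ m₂ μ₁ μ₂ lam : ℤ} {x : Zalpha a₁ a₂ a₃}
    (h : x ∈ idealSpan a₁ a₂ a₃ m₁ m₂ μ₁ μ₂ lam) :
    ∃ r s t : ℤ, x = (r : Zalpha a₁ a₂ a₃) * (alphaRoot a₁ a₂ a₃ ^ 2
      + ((μ₁ + a₁ : ℤ) : Zalpha a₁ a₂ a₃) * alphaRoot a₁ a₂ a₃ + (lam : Zalpha a₁ a₂ a₃))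
      + (s : Zalpha a₁ a₂ a₃) * ((m₁ : Zalpha a₁ a₂ a₃) * alphaRoot a₁ a₂ a₃
        - ((μ₂ * m₁ : ℤ) : Zalpha a₁ a₂ a₃))
      + (t : Zalpha a₁ a₂ a₃) * ((m₁ * m₂ : ℤ) : Zalpha a₁ a₂ a₃) := by
  unfold idealSpan at h
  rw [Submodule.mem_span_triple] at h
  obtain ⟨r, s, t, h⟩ := h
  exact ⟨r, s, t, by rw [← h]; simp only [zsmul_eq_mul]⟩

theorem maximal_key (a₁ a₂ a₃ : ℤ)
    (hirr : Irreducible (Fcubic a₁ a₂ a₃))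
    (hic : IsIntegrallyClosed (Zalpha a₁ a₂ a₃)) (g μ c d : ℤ) (hg : 0 < g)
    (hc : 3 * μ ^ 2 + 2 * a₁ * μ + a₂ = g * c)
    (hd : μ ^ 3 + a₁ * μ ^ 2 + a₂ * μ + a₃ = g ^ 2 * d) : g ∣ 1 := by
  have : IsDomain (Zalpha a₁ a₂ a₃) := AdjoinRoot.isDomain_of_prime hirr.prime
  set A := alphaRoot a₁ a₂ a₃ with hA
  have hrel := alpha_rel a₁ a₂ a₃
  rw [← hA] at hrel
  have hc' := congrArg (fun z : ℤ => (z : Zalpha a₁ a₂ a₃)) hc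
  have hd' := congrArg (fun z : ℤ => (z : Zalpha a₁ a₂ a₃)) hd
  push_cast at hc' hd'
  have hg0 : (g : Zalpha a₁ a₂ a₃) ≠ 0 := by
    intro h
    have := (coord_zero a₁ a₂ a₃ g 0 0 (by simpa using h)).2.2
    omega
  set t : Zalpha a₁ a₂ a₃ := A - μ with ht
  set b : Zalpha a₁ a₂ a₃ := 3 * μ + a₁ with hb
  set x : Zalpha a₁ a₂ a₃ := t ^ 2 + b * t with hx
  have hF : t * x + g * c * t + g ^ 2 * d = 0 := by
    rw [← hc', ← hd', hx, hb, ht]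
    linear_combination hrel
  have hq : x ^ 2 + c * g * x + d * (t + b) * g ^ 2 = 0 := by
    linear_combination (t + b) * hF + (x + c * g) * hx
  let K := FractionRing (Zalpha a₁ a₂ a₃)
  let φ := algebraMap (Zalpha a₁ a₂ a₃) K
  have hφg : φ g ≠ 0 := by
    intro h
    exact hg0 ((map_eq_zero_iff φ (IsFractionRing.injective _ K)).1 h)
  have hint : IsIntegral (Zalpha a₁ a₂ a₃) (φ x / φ g) := by
    refine ⟨X ^ 2 + C (c : Zalpha a₁ a₂ a₃) * X + C (d * (t + b)), by monicity!, ?_⟩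
    have h2 := congrArg φ hq
    simp only [map_add, map_mul, map_pow, map_zero] at h2
    simp only [eval₂_add, eval₂_mul, eval₂_pow, eval₂_X, eval₂_C]
    change (φ x / φ g) ^ 2 + φ c * (φ x / φ g) + φ (d * (t + b)) = 0
    simp only [map_add, map_mul]
    have hz : φ x = (φ x / φ g) * φ g := (div_mul_cancel₀ _ hφg).symm
    apply mul_left_cancel₀ (pow_ne_zero 2 hφg)
    generalize φ x / φ g = z at hz ⊢
    rw [hz] at h2
    linear_combination h2
  obtain ⟨y, hy⟩ := (IsIntegrallyClosed.isIntegral_iff (K := K)).1 hint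
  have hxy : x = g * y := by
    apply IsFractionRing.injective (Zalpha a₁ a₂ a₃) K
    change φ x = φ (g * y)
    rw [map_mul]
    change φ y = _ at hy
    rw [hy]
    exact (mul_div_cancel₀ _ hφg).symm
  obtain ⟨u, v, w, hy'⟩ := coord_exists a₁ a₂ a₃ y
  rw [← hA] at hy'
  have := (coord_zero a₁ a₂ a₃ (μ ^ 2 - (3 * μ + a₁) * μ - g * u)
    (-2 * μ + (3 * μ + a₁) - g * v) (1 - g * w) (by
      rw [← hA]
      push_cast
      rw [hy', hx, hb, ht] at hxy
      linear_combination hxy)).1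
  exact ⟨w, by linarith⟩

/-- If `ℤ[α]` is integrally closed (the maximal order of `ℚ(α)`), `F(μ₁) ≡ 0 (mod m₁)`,
`F(μ₂) ≡ 0 (mod m₂)`, and the `ℤ`-span of `{α² + (μ₁ + a₁)α + λ, m₁α - μ₂m₁, m₁m₂}`
is an ideal of `ℤ[α]` (closed under multiplication by `α`), then
`gcd(m₁, m₂, μ₁ - μ₂) = 1`. -/
theorem gcd_eq_one_of_ideal
    (a₁ a₂ a₃ : ℤ)
    (hirr : Irreducible (Fcubic a₁ a₂ a₃))
    (hic : IsIntegrallyClosed (Zalpha a₁ a₂ a₃))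
    (m₁ m₂ : ℤ) (hm₁ : 0 < m₁) (hm₂ : 0 < m₂) (μ₁ μ₂ lam : ℤ)
    (h₁ : m₁ ∣ μ₁ ^ 3 + a₁ * μ₁ ^ 2 + a₂ * μ₁ + a₃)
    (h₂ : m₂ ∣ μ₂ ^ 3 + a₁ * μ₂ ^ 2 + a₂ * μ₂ + a₃)
    (hideal : ∀ x ∈ idealSpan a₁ a₂ a₃ m₁ m₂ μ₁ μ₂ lam,
      alphaRoot a₁ a₂ a₃ * x ∈ idealSpan a₁ a₂ a₃ m₁ m₂ μ₁ μ₂ lam) :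
    Int.gcd ((Int.gcd m₁ m₂ : ℕ) : ℤ) (μ₁ - μ₂) = 1 := by
  set A := alphaRoot a₁ a₂ a₃ with hA
  have hrel := alpha_rel a₁ a₂ a₃
  rw [← hA] at hrel
  obtain ⟨r, s, t, e⟩ := span_coord (hideal _ (Submodule.subset_span (Set.mem_insert _ _)))
  obtain ⟨r', s', t', e'⟩ := span_coord (hideal _ (Submodule.subset_span
    (Set.mem_insert_of_mem _ (Set.mem_insert _ _))))
  rw [← hA] at e e'
  push_cast at e e'
  obtain ⟨p1, p2, p3⟩ := coord_zero a₁ a₂ a₃ (-a₃ - r * lam + s * μ₂ * m₁ - t * m₁ * m₂)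
    (lam - a₂ - r * (μ₁ + a₁) - s * m₁) (μ₁ - r) (by
      rw [← hA]; push_cast; linear_combination e - hrel)
  obtain ⟨q1, q2, q3⟩ := coord_zero a₁ a₂ a₃ (- r' * lam + s' * μ₂ * m₁ - t' * m₁ * m₂)
    (- μ₂ * m₁ - r' * (μ₁ + a₁) - s' * m₁) (m₁ - r') (by
      rw [← hA]; push_cast; linear_combination e')
  obtain rfl : r = μ₁ := by linarith
  obtain rfl : r' = m₁ := by linarith
  have hs' : s' = - μ₂ - (r + a₁) := by
    apply mul_left_cancel₀ hm₁.ne'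
    linarith
  have ht' : -lam + s' * μ₂ - t' * m₂ = 0 := by
    apply mul_left_cancel₀ hm₁.ne'
    linarith
  set g : ℕ := Int.gcd ((Int.gcd r' m₂ : ℕ) : ℤ) (r - μ₂) with hg
  have g12 : (g : ℤ) ∣ ((Int.gcd r' m₂ : ℕ) : ℤ) := Int.gcd_dvd_left _ _
  obtain ⟨k1, hk1⟩ : (g : ℤ) ∣ r' := g12.trans (Int.gcd_dvd_left _ _)
  obtain ⟨k2, hk2⟩ : (g : ℤ) ∣ m₂ := g12.trans (Int.gcd_dvd_right _ _)
  obtain ⟨k3, hk3⟩ : (g : ℤ) ∣ r - μ₂ := Int.gcd_dvd_right _ _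
  have hgpos : 0 < (g : ℤ) := by
    rcases Nat.eq_zero_or_pos g with h | h
    · rw [h] at hk1; simp at hk1; omega
    · exact_mod_cast h
  clear_value g
  have hμ : μ₂ = r - g * k3 := by linarith
  have key := maximal_key a₁ a₂ a₃ hirr hic g r
    (-s * k1 - t' * k2 + k3 * (3 * r + a₁ - g * k3)) (-s * k1 * k3 - t * k1 * k2) hgpos
    (by subst hs'; subst hμ; subst hk1; subst hk2; linear_combination (-1) * p2 - ht')
    (by subst hs'; subst hμ; subst hk1; subst hk2; linear_combination (-r) * p2 - p3)
  exact_mod_cast Int.eq_one_of_dvd_one hgpos.le key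
end
end
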